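/- arXiv:1810.02077 — 8 statements merged into one kernel-verified Lean document; each statement's English description precedes it below -/
import Mathlib

section
/- The kernel of φ is the principal ideal of K[T0,T1,X,Y] generated by α·Y − β·X. -/
open MvPolynomial

noncomputable section

/-- The polynomial ring `K[T0,T1]`. -/
abbrev PT (K : Type) [Field K] := MvPolynomial (Fin 2) K

/-- The polynomial ring `K[T0,T1,X,Y]`; `Sum.inl` indexes `T0,T1`,
`Sum.inr 0 = X`, `Sum.inr 1 = Y`. -/
abbrev PTXY (K : Type) [Field K] := MvPolynomial (Fin 2 ⊕ Fin 2) K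

/-- The polynomial ring `K[T0,T1,s]`; `Sum.inr () = s`. -/
abbrev PTs (K : Type) [Field K] := MvPolynomial (Fin 2 ⊕ Unit) K

/-- The map `φ : K[T0,T1,X,Y] → K[T0,T1,s]`, fixing `T0,T1`, with
`X ↦ α·s`, `Y ↦ β·s`. -/
def phiMap (K : Type) [Field K] (α β : PT K) : PTXY K →ₐ[K] PTs K :=
  aeval (Sum.elim (fun i => X (Sum.inl i))
    ![rename Sum.inl α * X (Sum.inr ()), rename Sum.inl β * X (Sum.inr ())])

/-- Modulo `α·Y − β·X` and up to a power of `α`, the variable `Y` can be eliminated from any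
polynomial. -/
theorem exists_dvd_pow_mul_sub (K : Type) [Field K] (α β : PT K) (F : PTXY K) :
    ∃ (n : ℕ) (g : Polynomial (PT K)),
      (rename Sum.inl α : PTXY K) * X (Sum.inr 1) - (rename Sum.inl β : PTXY K) * X (Sum.inr 0) ∣
        rename Sum.inl α ^ n * F -
          g.eval₂ (rename (R := K) (Sum.inl : Fin 2 → Fin 2 ⊕ Fin 2)).toRingHom
            (X (Sum.inr 0)) := by
  induction F using MvPolynomial.induction_on with
  | C a => exact ⟨0, Polynomial.C (C a), by simp⟩
  | add p q hp hq =>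
    obtain ⟨n, g, u, hu⟩ := hp
    obtain ⟨m, h, v, hv⟩ := hq
    refine ⟨n + m, Polynomial.C (α ^ m) * g + Polynomial.C (α ^ n) * h,
      rename Sum.inl α ^ m * u + rename Sum.inl α ^ n * v, ?_⟩
    simp only [AlgHom.toRingHom_eq_coe] at hu hv ⊢
    simp only [Polynomial.eval₂_add, Polynomial.eval₂_mul, Polynomial.eval₂_C,
      RingHom.coe_coe, map_pow (rename _)]
    linear_combination rename Sum.inl α ^ m * hu + rename Sum.inl α ^ n * hv
  | mul_X p i hp =>
    obtain ⟨n, g, u, hu⟩ := hp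
    simp only [AlgHom.toRingHom_eq_coe] at hu ⊢
    rcases i with i | i
    · refine ⟨n, Polynomial.C (X i) * g, X (Sum.inl i) * u, ?_⟩
      simp only [Polynomial.eval₂_mul, Polynomial.eval₂_C, RingHom.coe_coe, rename_X]
      linear_combination X (Sum.inl i) * hu
    · fin_cases i
      · refine ⟨n, Polynomial.X * g, X (Sum.inr 0) * u, ?_⟩
        simp only [Polynomial.eval₂_mul, Polynomial.eval₂_X, Fin.zero_eta]
        linear_combination X (Sum.inr 0) * hu
      · refine ⟨n + 1, Polynomial.C β * Polynomial.X * g,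
          rename Sum.inl α * X (Sum.inr 1) * u +
            g.eval₂ (rename (R := K) (Sum.inl : Fin 2 → Fin 2 ⊕ Fin 2)).toRingHom
              (X (Sum.inr 0)), ?_⟩
        simp only [Polynomial.eval₂_mul, Polynomial.eval₂_X, Polynomial.eval₂_C,
          RingHom.coe_coe, Fin.mk_one, AlgHom.toRingHom_eq_coe]
        linear_combination rename Sum.inl α * X (Sum.inr 1) * hu

theorem phiMap_rename_inl (K : Type) [Field K] (α β a : PT K) :
    phiMap K α β (rename Sum.inl a) = rename Sum.inl a := by
  have : (phiMap K α β).comp (rename Sum.inl) = rename Sum.inl := by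
    ext i : 1
    simp [phiMap]
  exact DFunLike.congr_fun this a

/-- `φ` is injective on `K[T0,T1,X]`. -/
theorem eq_zero_of_phiMap_eval₂_eq_zero (K : Type) [Field K] {α β : PT K} (hα0 : α ≠ 0)
    {g : Polynomial (PT K)}
    (h : phiMap K α β (g.eval₂ (rename (R := K) (Sum.inl : Fin 2 → Fin 2 ⊕ Fin 2)).toRingHom
      (X (Sum.inr 0))) = 0) : g = 0 := by
  let κ : PTs K →ₐ[K] Polynomial (PT K) :=
    aeval (Sum.elim (fun i => Polynomial.C (X i)) fun _ => Polynomial.X)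
  have hκ (a : PT K) : κ (rename Sum.inl a) = Polynomial.C a := by
    have : κ.comp (rename Sum.inl) =
        (Algebra.ofId (PT K) (Polynomial (PT K))).restrictScalars K := by
      ext i : 1
      simp [κ, Algebra.ofId_apply, Polynomial.algebraMap_eq]
    exact DFunLike.congr_fun this a
  have hcomp : g.comp (Polynomial.C α * Polynomial.X) = 0 := by
    rw [← map_zero κ, ← h, ← AlgHom.comp_apply, ← AlgHom.coe_toRingHom (κ.comp _),
      Polynomial.hom_eval₂, Polynomial.comp]
    congr 1
    · refine RingHom.ext fun a => ?_
      simp [phiMap_rename_inl, hκ]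
    · simp [phiMap, hκ, κ]
  ext1 n
  have := congrArg (Polynomial.coeff · n) hcomp
  simpa [Polynomial.comp_C_mul_X_coeff, hα0] using this

theorem prime_rename_of_injective {σ τ R : Type*} [CommRing R] {f : σ → τ}
    (hf : Function.Injective f) {p : MvPolynomial σ R} (hp : Prime p) : Prime (rename f p) := by
  have h : rename f p =
      rename Subtype.val (renameEquiv R (Equiv.ofInjective f hf) p) := by
    rw [renameEquiv_apply, rename_rename]
    rfl
  rw [h, prime_rename_iff]
  exact (MulEquiv.prime_iff (renameEquiv R (Equiv.ofInjective f hf))).mpr hp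

/-- A power of `α` can be cancelled modulo `α·Y − β·X`. -/
theorem dvd_of_dvd_rename_pow_mul (K : Type) [Field K] {α β : PT K} (hα0 : α ≠ 0)
    (hcop : IsRelPrime α β) (n : ℕ) {F : PTXY K}
    (h : (rename Sum.inl α : PTXY K) * X (Sum.inr 1) - (rename Sum.inl β : PTXY K) * X (Sum.inr 0) ∣
      rename Sum.inl α ^ n * F) :
    (rename Sum.inl α : PTXY K) * X (Sum.inr 1) - (rename Sum.inl β : PTXY K) * X (Sum.inr 0) ∣
      F := by
  set P : PTXY K := rename Sum.inl α * X (Sum.inr 1) - rename Sum.inl β * X (Sum.inr 0) with hP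
  have key (a : PT K) (ha : a ∣ α ^ n) (h : P ∣ rename Sum.inl a * F) : P ∣ F := by
    induction a using WfDvdMonoid.induction_on_irreducible with
    | zero => exact absurd (zero_dvd_iff.mp ha) (pow_ne_zero n hα0)
    | unit u hu => exact ((hu.map (rename Sum.inl)).dvd_mul_left).mp h
    | mul b q hb hq ih =>
      refine ih (dvd_of_mul_left_dvd ha) ?_
      obtain ⟨H, hH⟩ := h
      have hqα : q ∣ α := hq.prime.dvd_of_dvd_pow (dvd_of_mul_right_dvd ha)
      have hprime : Prime (rename Sum.inl q : PTXY K) :=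
        prime_rename_of_injective Sum.inl_injective hq.prime
      have hnP : ¬ (rename Sum.inl q : PTXY K) ∣ P := by
        intro hdvd
        let ε : PTXY K →ₐ[K] PT K := aeval (Sum.elim X ![-1, 0])
        have hε (a : PT K) : ε (rename Sum.inl a) = a := by
          rw [aeval_rename, Sum.elim_comp_inl, aeval_X_left_apply]
        have := map_dvd ε hdvd
        rw [hε, hP, map_sub, map_mul, map_mul, hε, hε] at this
        exact hq.not_isUnit (hcop hqα (by simpa [ε] using this))
      have : (rename Sum.inl q : PTXY K) ∣ P * H :=
        hH ▸ ⟨rename Sum.inl b * F, by rw [map_mul]; ring⟩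
      obtain ⟨H', rfl⟩ := (hprime.dvd_or_dvd this).resolve_left hnP
      refine ⟨H', mul_left_cancel₀ hprime.ne_zero ?_⟩
      rw [map_mul] at hH
      linear_combination hH
  exact key (α ^ n) dvd_rfl (by rwa [map_pow])

theorem stmt0 (K : Type) [Field K] (d μ1 μ2 : ℕ) (hμ12 : μ1 ≤ μ2)
    (hd : 2 * (μ1 + μ2) ≤ d)
    (α β : PT K) (hα0 : α ≠ 0) (hβ0 : β ≠ 0)
    (hα : α.IsHomogeneous (d - μ1)) (hβ : β.IsHomogeneous (d - μ2))
    (hcop : ∀ c : PT K, c ∣ α → c ∣ β → IsUnit c) :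
    RingHom.ker (phiMap K α β) =
      Ideal.span {(rename Sum.inl α : PTXY K) * X (Sum.inr 1)
        - (rename Sum.inl β : PTXY K) * X (Sum.inr 0)} := by
  have hφ : phiMap K α β ((rename Sum.inl α : PTXY K) * X (Sum.inr 1)
      - (rename Sum.inl β : PTXY K) * X (Sum.inr 0)) = 0 := by
    rw [map_sub, map_mul, map_mul, phiMap_rename_inl, phiMap_rename_inl]
    simp only [phiMap, aeval_X, Sum.elim_inr, Matrix.cons_val_zero, Matrix.cons_val_one]
    ring
  ext F
  rw [RingHom.mem_ker, Ideal.mem_span_singleton]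
  constructor
  · intro hF
    obtain ⟨n, g, hg⟩ := exists_dvd_pow_mul_sub K α β F
    have hg0 : g = 0 := by
      refine eq_zero_of_phiMap_eval₂_eq_zero K (β := β) hα0 ?_
      have := map_dvd (phiMap K α β) hg
      rw [hφ, zero_dvd_iff, map_sub, map_mul, hF, mul_zero, zero_sub, neg_eq_zero] at this
      exact this
    rw [hg0, Polynomial.eval₂_zero, sub_zero] at hg
    exact dvd_of_dvd_rename_pow_mul K hα0 (fun c => hcop c) n hg
  · rintro ⟨H, rfl⟩
    rw [map_mul, hφ, zero_mul]
end
end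

section
/- The kernel of Φ is the preimage under Φ' of the principal ideal generated by α·Y − β·X; that is, for every F ∈ K[T0,T1,X_0,…,X_{μ1},Y_0,…,Y_{μ2}], one has Φ(F) = 0 if and only if Φ'(F) belongs to the ideal ⟨α·Y − β·X⟩ of K[T0,T1,X,Y]. -/
open MvPolynomial

noncomputable section

/-- The polynomial ring `K[T0,T1,X_0,…,X_{μ1},Y_0,…,Y_{μ2}]`. -/
abbrev PBig (K : Type) [Field K] (μ1 μ2 : ℕ) :=
  MvPolynomial (Fin 2 ⊕ (Fin (μ1+1) ⊕ Fin (μ2+1))) K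

/-- The map `Φ`, fixing `T0,T1`, with `X_i ↦ α·T0^{μ1-i}·T1^i·s` and
`Y_i ↦ β·T0^{μ2-i}·T1^i·s`. -/
def PhiMap (K : Type) [Field K] (μ1 μ2 : ℕ) (α β : PT K) :
    PBig K μ1 μ2 →ₐ[K] PTs K :=
  aeval (Sum.elim (fun i => X (Sum.inl i))
    (Sum.elim
      (fun i => rename Sum.inl α * X (Sum.inl 0) ^ (μ1 - (i : ℕ)) *
        X (Sum.inl 1) ^ (i : ℕ) * X (Sum.inr ()))
      (fun i => rename Sum.inl β * X (Sum.inl 0) ^ (μ2 - (i : ℕ)) *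
        X (Sum.inl 1) ^ (i : ℕ) * X (Sum.inr ()))))

/-- The map `Φ'`, fixing `T0,T1`, with `X_i ↦ T0^{μ1-i}·T1^i·X` and
`Y_i ↦ T0^{μ2-i}·T1^i·Y`. -/
def Phi'Map (K : Type) [Field K] (μ1 μ2 : ℕ) :
    PBig K μ1 μ2 →ₐ[K] PTXY K :=
  aeval (Sum.elim (fun i => X (Sum.inl i))
    (Sum.elim
      (fun i => X (Sum.inl 0) ^ (μ1 - (i : ℕ)) * X (Sum.inl 1) ^ (i : ℕ) * X (Sum.inr 0))
      (fun i => X (Sum.inl 0) ^ (μ2 - (i : ℕ)) * X (Sum.inl 1) ^ (i : ℕ) * X (Sum.inr 1))))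

section RenameInl

variable {K σ τ : Type*} [Field K]

/-- A divisor of a nonzero polynomial in the first group of variables only involves these
variables. -/
theorem exists_rename_inl_of_dvd {a : MvPolynomial σ K} (ha : a ≠ 0)
    {c : MvPolynomial (σ ⊕ τ) K} (hc : c ∣ rename Sum.inl a) :
    ∃ b : MvPolynomial σ K, rename Sum.inl b = c ∧ b ∣ a := by
  classical
  have hinj : Function.Injective (Sum.inl : σ → σ ⊕ τ) := Sum.inl_injective
  have ha' : rename (Sum.inl : σ → σ ⊕ τ) a ≠ 0 := by
    rwa [Ne, map_eq_zero_iff _ (rename_injective _ hinj)]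
  obtain ⟨e, he⟩ := hc
  have hc0 : c ≠ 0 := by rintro rfl; simp [he] at ha'
  have he0 : e ≠ 0 := by rintro rfl; simp [he] at ha'
  have hvars : (c.vars : Set (σ ⊕ τ)) ⊆ Set.range Sum.inl := by
    intro i hi
    have hi' : i ∈ (rename (Sum.inl : σ → σ ⊕ τ) a).vars := by
      rw [Finset.mem_coe, mem_vars_iff_degreeOf_ne_zero] at hi
      rw [mem_vars_iff_degreeOf_ne_zero, he, degreeOf_mul_eq hc0 he0]
      omega
    obtain ⟨j, -, hj⟩ := Finset.mem_image.mp (vars_rename _ _ hi')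
    exact ⟨j, hj⟩
  obtain ⟨b, rfl⟩ := exists_rename_eq_of_vars_subset_range c Sum.inl hinj hvars
  refine ⟨b, rfl, killCompl hinj e, ?_⟩
  simpa [killCompl_rename_app] using congrArg (killCompl hinj) he

theorem IsRelPrime.rename_inl {a b : MvPolynomial σ K} (ha : a ≠ 0) (h : IsRelPrime a b) :
    IsRelPrime (rename Sum.inl a : MvPolynomial (σ ⊕ τ) K) (rename Sum.inl b) := by
  intro c hca hcb
  have hinj : Function.Injective (Sum.inl : σ → σ ⊕ τ) := Sum.inl_injective
  obtain ⟨c, rfl, hc⟩ := exists_rename_inl_of_dvd ha hca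
  refine (h hc ?_).map (rename Sum.inl)
  simpa [killCompl_rename_app] using map_dvd (killCompl hinj) hcb

theorem isRelPrime_rename_inl_X_inr {a : MvPolynomial σ K} (ha : a ≠ 0) (j : τ) :
    IsRelPrime (rename Sum.inl a : MvPolynomial (σ ⊕ τ) K) (X (Sum.inr j)) := by
  refine ((X_prime (i := Sum.inr j)).irreducible.isRelPrime_iff_not_dvd.mpr fun hdvd => ha ?_).symm
  have h := map_dvd (aeval (Sum.elim X 0) : MvPolynomial (σ ⊕ τ) K →ₐ[K] MvPolynomial σ K) hdvd
  have hid : (aeval (Sum.elim X 0) : MvPolynomial (σ ⊕ τ) K →ₐ[K] MvPolynomial σ K).comp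
      (rename Sum.inl) = AlgHom.id K _ := by
    ext1 i
    rw [AlgHom.comp_apply, rename_X, aeval_X, Sum.elim_inl, AlgHom.id_apply]
  have ha' := DFunLike.congr_fun hid a
  rw [AlgHom.comp_apply, AlgHom.id_apply] at ha'
  rwa [ha', aeval_X, Sum.elim_inr, Pi.zero_apply, zero_dvd_iff] at h

/-- The substitution `s ↦ a s` with `a ≠ 0` free of `s` is injective. -/
theorem aeval_mul_X_injective {a : MvPolynomial σ K} (ha : a ≠ 0) :
    Function.Injective (aeval (Sum.elim (fun i => X (Sum.inl i))
      (fun j => rename Sum.inl a * X (Sum.inr j))) :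
        MvPolynomial (σ ⊕ τ) K →ₐ[K] MvPolynomial (σ ⊕ τ) K) := by
  obtain ⟨ι, hι⟩ : ∃ ι : MvPolynomial (σ ⊕ τ) K →ₐ[K] FractionRing (MvPolynomial (σ ⊕ τ) K),
      Function.Injective ι :=
    ⟨IsScalarTower.toAlgHom K _ _, IsFractionRing.injective (MvPolynomial (σ ⊕ τ) K) _⟩
  have ha' : ι (rename Sum.inl a) ≠ 0 := by
    rw [Ne, map_eq_zero_iff _ hι, map_eq_zero_iff _ (rename_injective _ Sum.inl_injective)]
    exact ha
  obtain ⟨θ, hθl, hθr⟩ :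
      ∃ θ : MvPolynomial (σ ⊕ τ) K →ₐ[K] FractionRing (MvPolynomial (σ ⊕ τ) K),
        (∀ i, θ (X (Sum.inl i)) = ι (X (Sum.inl i))) ∧
        ∀ j, θ (X (Sum.inr j)) = ι (X (Sum.inr j)) / ι (rename Sum.inl a) :=
    ⟨aeval (Sum.elim (fun i => ι (X (Sum.inl i)))
      (fun j => ι (X (Sum.inr j)) / ι (rename Sum.inl a))), fun i => by rw [aeval_X]; rfl,
      fun j => by rw [aeval_X]; rfl⟩
  have hθ : θ (rename Sum.inl a) = ι (rename Sum.inl a) := by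
    have : θ.comp (rename Sum.inl) = ι.comp (rename Sum.inl) := by
      ext1 i
      simp only [AlgHom.comp_apply, rename_X, hθl]
    exact DFunLike.congr_fun this a
  have hcomp : θ.comp (aeval (Sum.elim (fun i => X (Sum.inl i))
      (fun j => rename Sum.inl a * X (Sum.inr j)))) = ι := by
    ext1 (i | j)
    · simp only [AlgHom.comp_apply, aeval_X, Sum.elim_inl, hθl]
    · simp only [AlgHom.comp_apply, aeval_X, Sum.elim_inr, map_mul, hθ, hθr]
      exact mul_div_cancel₀ _ ha'
  refine Function.Injective.of_comp (f := θ) ?_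
  rw [← AlgHom.coe_comp, hcomp]
  exact hι

end RenameInl

section TwoVariables

variable {K σ : Type*} [Field K]

/-- The substitution `X ↦ a s`, `Y ↦ b s`, fixing the first group of variables. -/
def scaleMap (a b : MvPolynomial σ K) :
    MvPolynomial (σ ⊕ Fin 2) K →ₐ[K] MvPolynomial (σ ⊕ Unit) K :=
  aeval (Sum.elim (fun i => X (Sum.inl i))
    ![rename Sum.inl a * X (Sum.inr ()), rename Sum.inl b * X (Sum.inr ())])

theorem scaleMap_rename_inl (a b p : MvPolynomial σ K) :
    scaleMap a b (rename Sum.inl p) = rename Sum.inl p := by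
  have h : (scaleMap a b).comp (rename Sum.inl) = rename Sum.inl := by
    ext1 i
    rw [AlgHom.comp_apply, rename_X, rename_X, scaleMap, aeval_X, Sum.elim_inl]
  exact DFunLike.congr_fun h p

/-- Modulo `a Y - b X`, a multiple of `G` by a power of `a` does not involve `Y`. -/
theorem exists_dvd_pow_mul_sub_rename (a b : MvPolynomial σ K) (G : MvPolynomial (σ ⊕ Fin 2) K) :
    ∃ (n : ℕ) (H : MvPolynomial (σ ⊕ Unit) K),
      rename Sum.inl a * X (Sum.inr 1) - rename Sum.inl b * X (Sum.inr 0) ∣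
        rename Sum.inl a ^ n * G - rename (Sum.map id fun _ => 0) H := by
  have hren (p : MvPolynomial σ K) : rename (Sum.map id fun _ => (0 : Fin 2))
      (rename (Sum.inl : σ → σ ⊕ Unit) p) = rename Sum.inl p := by
    rw [rename_rename]; rfl
  induction G using MvPolynomial.induction_on with
  | C k => exact ⟨0, C k, by simp⟩
  | add p q hp hq =>
    obtain ⟨n, H, u, hu⟩ := hp
    obtain ⟨m, H', v, hv⟩ := hq
    refine ⟨n + m, rename Sum.inl a ^ m * H + rename Sum.inl a ^ n * H',
      rename Sum.inl a ^ m * u + rename Sum.inl a ^ n * v, ?_⟩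
    simp only [map_add, map_mul, map_pow, hren]
    linear_combination rename Sum.inl a ^ m * hu + rename Sum.inl a ^ n * hv
  | mul_X p i hp =>
    obtain ⟨n, H, u, hu⟩ := hp
    rcases i with i | j
    · refine ⟨n, H * X (Sum.inl i), u * X (Sum.inl i), ?_⟩
      simp only [map_mul, rename_X, Sum.map_inl, id]
      linear_combination X (Sum.inl i) * hu
    · fin_cases j
      · refine ⟨n, H * X (Sum.inr ()), u * X (Sum.inr 0), ?_⟩
        simp only [map_mul, rename_X, Sum.map_inr, Fin.zero_eta]
        linear_combination X (Sum.inr 0) * hu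
      · refine ⟨n + 1, H * rename Sum.inl b * X (Sum.inr ()),
          rename Sum.inl a * X (Sum.inr 1) * u + rename (Sum.map id fun _ => 0) H, ?_⟩
        simp only [map_mul, rename_X, Sum.map_inr, hren, Fin.mk_one]
        linear_combination rename Sum.inl a * X (Sum.inr 1) * hu

/-- For coprime `a` and `b`, the kernel of `X ↦ a s`, `Y ↦ b s` is generated by `a Y - b X`. -/
theorem scaleMap_eq_zero_iff {a b : MvPolynomial σ K} (ha : a ≠ 0)
    (hab : IsRelPrime a b) (G : MvPolynomial (σ ⊕ Fin 2) K) :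
    scaleMap a b G = 0 ↔
      rename Sum.inl a * X (Sum.inr 1) - rename Sum.inl b * X (Sum.inr 0) ∣ G := by
  have hL : scaleMap a b
      (rename Sum.inl a * X (Sum.inr 1) - rename Sum.inl b * X (Sum.inr 0)) = 0 := by
    rw [map_sub, map_mul, map_mul, scaleMap_rename_inl, scaleMap_rename_inl]
    simp only [scaleMap, aeval_X, Sum.elim_inr, Matrix.cons_val_zero, Matrix.cons_val_one]
    ring
  constructor
  · intro hG
    obtain ⟨n, H, hH⟩ := exists_dvd_pow_mul_sub_rename a b G
    have hrestr : (scaleMap a b).comp (rename (Sum.map id fun _ => 0)) =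
        aeval (Sum.elim (fun i => X (Sum.inl i))
          (fun j : Unit => rename Sum.inl a * X (Sum.inr j))) := by
      ext (i | j) <;> simp [scaleMap]
    have hH0 : H = 0 := by
      apply aeval_mul_X_injective ha
      obtain ⟨u, hu⟩ := hH
      have h := congrArg (scaleMap a b) hu
      rw [map_mul, hL, zero_mul, map_sub, map_mul, hG, mul_zero, zero_sub, neg_eq_zero] at h
      rw [map_zero, ← hrestr]
      exact h
    rw [hH0, map_zero, sub_zero] at hH
    have hrel : IsRelPrime (rename Sum.inl a)
        (rename Sum.inl a * X (Sum.inr 1) - rename Sum.inl b * X (Sum.inr (0 : Fin 2))) := by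
      intro c hca hcL
      exact (hab.rename_inl ha).mul_right (isRelPrime_rename_inl_X_inr ha 0) hca
        ((dvd_sub_right (hca.mul_right _)).mp hcL)
    exact hrel.pow_left.symm.dvd_of_dvd_mul_left hH
  · rintro ⟨u, rfl⟩
    rw [map_mul, hL, zero_mul]

end TwoVariables

theorem scaleMap_comp_Phi'Map (K : Type) [Field K] (μ1 μ2 : ℕ) (α β : PT K) :
    (scaleMap α β).comp (Phi'Map K μ1 μ2) = PhiMap K μ1 μ2 α β := by
  ext1 i
  rcases i with i | i | i
  · simp [scaleMap, PhiMap, Phi'Map]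
  all_goals
    simp only [scaleMap, PhiMap, Phi'Map, AlgHom.comp_apply, aeval_X, Sum.elim_inl, Sum.elim_inr,
      map_mul, map_pow, Matrix.cons_val_zero, Matrix.cons_val_one]
    ring

theorem stmt1 (K : Type) [Field K] (d μ1 μ2 : ℕ) (hμ12 : μ1 ≤ μ2)
    (hd : 2 * (μ1 + μ2) ≤ d)
    (α β : PT K) (hα0 : α ≠ 0) (hβ0 : β ≠ 0)
    (hα : α.IsHomogeneous (d - μ1)) (hβ : β.IsHomogeneous (d - μ2))
    (hcop : ∀ c : PT K, c ∣ α → c ∣ β → IsUnit c) :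
    ∀ F : PBig K μ1 μ2,
      PhiMap K μ1 μ2 α β F = 0 ↔
        Phi'Map K μ1 μ2 F ∈ Ideal.span {(rename Sum.inl α : PTXY K) * X (Sum.inr 1)
          - (rename Sum.inl β : PTXY K) * X (Sum.inr 0)} := by
  intro F
  rw [Ideal.mem_span_singleton, ← scaleMap_eq_zero_iff hα0 (fun c => hcop c),
    ← scaleMap_comp_Phi'Map, AlgHom.comp_apply]
end
end

section
/- The kernel of Φ' equals the ideal of K[T0,T1,X_0,…,X_{μ1},Y_0,…,Y_{μ2}] generated by the set of all polynomials F in the kernel of Φ that are (X,Y)-bihomogeneous, i.e., homogeneous of some degree j in the variables X_0,…,X_{μ1} and homogeneous of some degree k in the variables Y_0,…,Y_{μ2}. -/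
open MvPolynomial

noncomputable section

/-- Weight function giving degree in the variables `X_0,…,X_{μ1}`. -/
def wX (μ1 μ2 : ℕ) : Fin 2 ⊕ (Fin (μ1+1) ⊕ Fin (μ2+1)) → ℕ :=
  Sum.elim (fun _ => 0) (Sum.elim (fun _ => 1) (fun _ => 0))

/-- Weight function giving degree in the variables `Y_0,…,Y_{μ2}`. -/
def wY (μ1 μ2 : ℕ) : Fin 2 ⊕ (Fin (μ1+1) ⊕ Fin (μ2+1)) → ℕ :=
  Sum.elim (fun _ => 0) (Sum.elim (fun _ => 0) (fun _ => 1))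

/-- An algebra map sending each variable to a weighted homogeneous element of the matching degree
preserves weighted homogeneity. -/
theorem isWeightedHomogeneous_algHom {R σ τ M : Type*} [CommSemiring R] [AddCommMonoid M]
    {w : σ → M} {v : τ → M} {f : MvPolynomial σ R →ₐ[R] MvPolynomial τ R}
    (hf : ∀ i, (f (X i)).IsWeightedHomogeneous v (w i)) {p : MvPolynomial σ R} {n : M}
    (hp : p.IsWeightedHomogeneous w n) : (f p).IsWeightedHomogeneous v n := by
  rw [aeval_unique f, aeval_def, eval₂_eq]
  refine IsWeightedHomogeneous.sum _ _ _ fun m hm => ?_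
  rw [← hp (mem_support_iff.mp hm), Finsupp.weight_apply, Finsupp.sum]
  exact (IsWeightedHomogeneous.prod _ _ _ fun i _ => (hf i).pow (m i)).C_mul _

/-- Such an algebra map commutes with taking weighted homogeneous components. -/
theorem map_weightedHomogeneousComponent {R σ τ M : Type*} [CommSemiring R] [AddCommMonoid M]
    {w : σ → M} {v : τ → M} {f : MvPolynomial σ R →ₐ[R] MvPolynomial τ R}
    (hf : ∀ i, (f (X i)).IsWeightedHomogeneous v (w i)) (n : M) (p : MvPolynomial σ R) :
    f (weightedHomogeneousComponent w n p) =
      weightedHomogeneousComponent v n (f p) := by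
  classical
  induction p using MvPolynomial.induction_on' with
  | monomial m r =>
    have hm : (monomial m r).IsWeightedHomogeneous w (Finsupp.weight w m) :=
      isWeightedHomogeneous_monomial w m r rfl
    rw [weightedHomogeneousComponent_of_mem hm,
      weightedHomogeneousComponent_of_mem (isWeightedHomogeneous_algHom hf hm)]
    split_ifs <;> simp
  | add p q hp hq => simp only [map_add, hp, hq]

/-- A weighted homogeneous component of a weighted homogeneous polynomial (for another weight)
remains weighted homogeneous. -/
theorem isWeightedHomogeneous_weightedHomogeneousComponent {R σ M N : Type*} [CommSemiring R]
    [AddCommMonoid M] [AddCommMonoid N] {w : σ → M} {v : σ → N} {p : MvPolynomial σ R} {m : M}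
    (hp : p.IsWeightedHomogeneous w m) (n : N) :
    (weightedHomogeneousComponent v n p).IsWeightedHomogeneous w m := by
  classical
  intro e he
  rw [coeff_weightedHomogeneousComponent] at he
  exact hp fun h => he (by simp [h])

/-- A polynomial in `T0, T1, X, Y` of degree `j` in `X` and `k` in `Y` is `g(T0,T1) X^j Y^k`. -/
theorem exists_eq_rename_mul_of_isWeightedHomogeneous {K : Type} [Field K] {P : PTXY K} {j k : ℕ}
    (hX : P.IsWeightedHomogeneous (Sum.elim (fun _ => 0) ![1, 0]) j)
    (hY : P.IsWeightedHomogeneous (Sum.elim (fun _ => 0) ![0, 1]) k) :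
    ∃ g : PT K, P = rename Sum.inl g * X (Sum.inr 0) ^ j * X (Sum.inr 1) ^ k := by
  refine ⟨∑ m ∈ P.support, C (coeff m P) * (X 0 ^ m (Sum.inl 0) * X 1 ^ m (Sum.inl 1)), ?_⟩
  conv_lhs => rw [P.as_sum]
  rw [map_sum, Finset.sum_mul, Finset.sum_mul]
  refine Finset.sum_congr rfl fun m hm => ?_
  have hj : m (Sum.inr 0) = j := by
    simpa [Finsupp.weight_apply, Finsupp.sum_fintype] using hX (mem_support_iff.mp hm)
  have hk : m (Sum.inr 1) = k := by
    simpa [Finsupp.weight_apply, Finsupp.sum_fintype] using hY (mem_support_iff.mp hm)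
  rw [monomial_eq, Finsupp.prod_fintype _ _ fun _ => pow_zero _, Fintype.prod_sum_type,
    Fin.prod_univ_two, Fin.prod_univ_two, hj, hk]
  simp only [map_mul, map_pow, rename_C, rename_X]
  ring

/-- The map `K[T0,T1,X,Y] → K[T0,T1,s]` with `X ↦ α s` and `Y ↦ β s`. -/
def specializeXY {K : Type} [Field K] (α β : PT K) : PTXY K →ₐ[K] PTs K :=
  aeval (Sum.elim (fun i => X (Sum.inl i))
    ![rename Sum.inl α * X (Sum.inr ()), rename Sum.inl β * X (Sum.inr ())])

theorem phiMap_eq_specializeXY {K : Type} [Field K] {μ1 μ2 : ℕ} (α β : PT K)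
    (F : PBig K μ1 μ2) : PhiMap K μ1 μ2 α β F = specializeXY α β (Phi'Map K μ1 μ2 F) := by
  suffices h : PhiMap K μ1 μ2 α β = (specializeXY α β).comp (Phi'Map K μ1 μ2) by
    rw [h, AlgHom.comp_apply]
  ext i : 1
  rcases i with i | i | i <;> simp [PhiMap, Phi'Map, specializeXY] <;> ring

theorem specializeXY_rename {K : Type} [Field K] (α β g : PT K) :
    specializeXY α β (rename Sum.inl g) = rename Sum.inl g := by
  suffices h : (specializeXY α β).comp (rename Sum.inl) = rename Sum.inl from
    DFunLike.congr_fun h g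
  ext i : 1
  simp [specializeXY]

/-- `specializeXY α β` is injective on polynomials bihomogeneous in `X` and `Y`. -/
theorem eq_zero_of_specializeXY_eq_zero {K : Type} [Field K] {α β : PT K} (hα : α ≠ 0)
    (hβ : β ≠ 0) {P : PTXY K} {j k : ℕ}
    (hX : P.IsWeightedHomogeneous (Sum.elim (fun _ => 0) ![1, 0]) j)
    (hY : P.IsWeightedHomogeneous (Sum.elim (fun _ => 0) ![0, 1]) k)
    (h : specializeXY α β P = 0) : P = 0 := by
  obtain ⟨g, rfl⟩ := exists_eq_rename_mul_of_isWeightedHomogeneous hX hY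
  have hinj : Function.Injective (rename Sum.inl : PT K → PTs K) :=
    rename_injective _ Sum.inl_injective
  have hα' : rename Sum.inl α * X (Sum.inr ()) ≠ (0 : PTs K) :=
    mul_ne_zero ((map_ne_zero_iff _ hinj).mpr hα) (X_ne_zero _)
  have hβ' : rename Sum.inl β * X (Sum.inr ()) ≠ (0 : PTs K) :=
    mul_ne_zero ((map_ne_zero_iff _ hinj).mpr hβ) (X_ne_zero _)
  have hs0 : specializeXY α β (X (Sum.inr 0)) = rename Sum.inl α * X (Sum.inr ()) := by
    simp [specializeXY]
  have hs1 : specializeXY α β (X (Sum.inr 1)) = rename Sum.inl β * X (Sum.inr ()) := by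
    simp [specializeXY]
  rw [map_mul, map_mul, map_pow, map_pow, hs0, hs1, specializeXY_rename, mul_eq_zero,
    or_iff_left (pow_ne_zero _ hβ'), mul_eq_zero, or_iff_left (pow_ne_zero _ hα'),
    map_eq_zero_iff _ hinj] at h
  simp [h]

theorem isWeightedHomogeneous_T_mul {K : Type} [Field K] (v : Fin 2 → ℕ) (a b : ℕ) (i : Fin 2) :
    (X (Sum.inl 0) ^ a * X (Sum.inl 1) ^ b * X (Sum.inr i) : PTXY K).IsWeightedHomogeneous
      (Sum.elim (fun _ => 0) v) (v i) := by
  simpa using (((isWeightedHomogeneous_X K (Sum.elim (fun _ : Fin 2 => 0) v) (Sum.inl 0)).pow a).mul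
    ((isWeightedHomogeneous_X K _ (Sum.inl 1)).pow b)).mul (isWeightedHomogeneous_X K _ (Sum.inr i))

theorem isWeightedHomogeneous_phi'Map_X {K : Type} [Field K] {μ1 μ2 : ℕ} (v : Fin 2 → ℕ)
    (i : Fin 2 ⊕ (Fin (μ1 + 1) ⊕ Fin (μ2 + 1))) :
    (Phi'Map K μ1 μ2 (X i)).IsWeightedHomogeneous (Sum.elim (fun _ => 0) v)
      (Sum.elim (fun _ => 0) (Sum.elim (fun _ => v 0) (fun _ => v 1)) i) := by
  rw [Phi'Map, aeval_X]
  rcases i with i | i | i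
  · exact isWeightedHomogeneous_X K _ (Sum.inl i)
  · exact isWeightedHomogeneous_T_mul v _ _ 0
  · exact isWeightedHomogeneous_T_mul v _ _ 1

theorem stmt2 (K : Type) [Field K] (d μ1 μ2 : ℕ) (hμ12 : μ1 ≤ μ2)
    (hd : 2 * (μ1 + μ2) ≤ d)
    (α β : PT K) (hα0 : α ≠ 0) (hβ0 : β ≠ 0)
    (hα : α.IsHomogeneous (d - μ1)) (hβ : β.IsHomogeneous (d - μ2))
    (hcop : ∀ c : PT K, c ∣ α → c ∣ β → IsUnit c) :
    RingHom.ker (Phi'Map K μ1 μ2) =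
      Ideal.span {F : PBig K μ1 μ2 | PhiMap K μ1 μ2 α β F = 0 ∧
        ∃ j k : ℕ, F.IsWeightedHomogeneous (wX μ1 μ2) j ∧
          F.IsWeightedHomogeneous (wY μ1 μ2) k} := by
  have hwX : ∀ i, (Phi'Map K μ1 μ2 (X i)).IsWeightedHomogeneous
      (Sum.elim (fun _ => 0) ![1, 0]) (wX μ1 μ2 i) := isWeightedHomogeneous_phi'Map_X ![1, 0]
  have hwY : ∀ i, (Phi'Map K μ1 μ2 (X i)).IsWeightedHomogeneous
      (Sum.elim (fun _ => 0) ![0, 1]) (wY μ1 μ2 i) := isWeightedHomogeneous_phi'Map_X ![0, 1]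
  apply le_antisymm
  · intro F hF
    rw [RingHom.mem_ker] at hF
    rw [← finsum_weightedHomogeneousComponent (wX μ1 μ2) F]
    refine finsum_induction (· ∈ Ideal.span _) (zero_mem _) (fun _ _ => add_mem) fun j => ?_
    rw [← finsum_weightedHomogeneousComponent (wY μ1 μ2) (weightedHomogeneousComponent _ j F)]
    refine finsum_induction (· ∈ Ideal.span _) (zero_mem _) (fun _ _ => add_mem) fun k => ?_
    refine Ideal.subset_span ⟨?_, j, k, isWeightedHomogeneous_weightedHomogeneousComponent
      (weightedHomogeneousComponent_isWeightedHomogeneous _ _) _,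
      weightedHomogeneousComponent_isWeightedHomogeneous _ _⟩
    rw [phiMap_eq_specializeXY, map_weightedHomogeneousComponent hwY,
      map_weightedHomogeneousComponent hwX, hF, map_zero, map_zero, map_zero]
  · refine Ideal.span_le.mpr ?_
    rintro F ⟨hF, j, k, hj, hk⟩
    rw [phiMap_eq_specializeXY] at hF
    exact eq_zero_of_specializeXY_eq_zero hα0 hβ0 (isWeightedHomogeneous_algHom hwX hj)
      (isWeightedHomogeneous_algHom hwY hk) hF
end
end

section
/- The kernel of Φ' is generated by the binomials T1·X_{i−1} − T0·X_i for 1 ≤ i ≤ μ1; T1·Y_{j−1} − T0·Y_j for 1 ≤ j ≤ μ2; X_i·X_j − X_{i−1}·X_{j+1} for 1 ≤ i ≤ j ≤ μ1−1; Y_i·Y_j − Y_{i−1}·Y_{j+1} for 1 ≤ i ≤ j ≤ μ2−1; and X_i·Y_j − X_{i−1}·Y_{j+1} for 1 ≤ i ≤ μ1 and 0 ≤ j ≤ μ2−1. Moreover this generating set is minimal: none of these binomials lies in the ideal generated by the remaining ones. -/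
open MvPolynomial

noncomputable section

/-- The variable `X_n` of `PBig` (as `n` ranges over `0,…,μ1`; junk value `0` out of range). -/
def Xn (K : Type) [Field K] (μ1 μ2 : ℕ) (n : ℕ) : PBig K μ1 μ2 :=
  if h : n < μ1 + 1 then X (Sum.inr (Sum.inl ⟨n, h⟩)) else 0

/-- The variable `Y_n` of `PBig` (as `n` ranges over `0,…,μ2`; junk value `0` out of range). -/
def Yn (K : Type) [Field K] (μ1 μ2 : ℕ) (n : ℕ) : PBig K μ1 μ2 :=
  if h : n < μ2 + 1 then X (Sum.inr (Sum.inr ⟨n, h⟩)) else 0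

/-- The family of binomial generators: pencils and quadrics. -/
def genSet (K : Type) [Field K] (μ1 μ2 : ℕ) : Set (PBig K μ1 μ2) :=
  {f | ∃ i : ℕ, 1 ≤ i ∧ i ≤ μ1 ∧
      f = X (Sum.inl 1) * Xn K μ1 μ2 (i-1) - X (Sum.inl 0) * Xn K μ1 μ2 i} ∪
  {f | ∃ j : ℕ, 1 ≤ j ∧ j ≤ μ2 ∧
      f = X (Sum.inl 1) * Yn K μ1 μ2 (j-1) - X (Sum.inl 0) * Yn K μ1 μ2 j} ∪
  {f | ∃ i j : ℕ, 1 ≤ i ∧ i ≤ j ∧ j + 1 ≤ μ1 ∧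
      f = Xn K μ1 μ2 i * Xn K μ1 μ2 j - Xn K μ1 μ2 (i-1) * Xn K μ1 μ2 (j+1)} ∪
  {f | ∃ i j : ℕ, 1 ≤ i ∧ i ≤ j ∧ j + 1 ≤ μ2 ∧
      f = Yn K μ1 μ2 i * Yn K μ1 μ2 j - Yn K μ1 μ2 (i-1) * Yn K μ1 μ2 (j+1)} ∪
  {f | ∃ i j : ℕ, 1 ≤ i ∧ i ≤ μ1 ∧ j + 1 ≤ μ2 ∧
      f = Xn K μ1 μ2 i * Yn K μ1 μ2 j - Xn K μ1 μ2 (i-1) * Yn K μ1 μ2 (j+1)}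

theorem multiset_prod_map_X_eq_monomial {σ R : Type*} [DecidableEq σ] [CommSemiring R]
    (S : Multiset σ) :
    (S.map (X : σ → MvPolynomial σ R)).prod = monomial (Multiset.toFinsupp S) 1 := by
  induction S using Multiset.induction with
  | empty => simp
  | cons a S ih =>
    rw [Multiset.map_cons, Multiset.prod_cons, ih, X, monomial_mul, ← Multiset.singleton_add a S,
      map_add, Multiset.toFinsupp_singleton, mul_one]

/-- The kernel of a map sending variables to monomials is contained in every ideal that
identifies monomials with equal image. -/
theorem ker_le_of_monomial_congr {σ τ R : Type*} [DecidableEq σ] [CommRing R]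
    (φ : MvPolynomial σ R →ₐ[R] MvPolynomial τ R) (w : σ → τ →₀ ℕ)
    (hφ : ∀ u, φ (X u) = monomial (w u) 1) (I : Ideal (MvPolynomial σ R))
    (hI : ∀ S T : Multiset σ, (S.map w).sum = (T.map w).sum →
      Ideal.Quotient.mk I (S.map X).prod = Ideal.Quotient.mk I (T.map X).prod) :
    RingHom.ker φ ≤ I := by
  classical
  have hmon : ∀ S : Multiset σ, φ (S.map X).prod = monomial (S.map w).sum 1 := by
    intro S
    induction S using Multiset.induction with
    | empty => simp
    | cons a S ih => simp [hφ, ih, monomial_mul]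
  let L : MvPolynomial τ R →ₗ[R] (MvPolynomial σ R ⧸ I) :=
    (basisMonomials τ R).constr R fun n =>
      if h : ∃ S : Multiset σ, (S.map w).sum = n then Ideal.Quotient.mk I (h.choose.map X).prod
      else 0
  have hL : L ∘ₗ φ.toLinearMap = (Ideal.Quotient.mkₐ R I).toLinearMap := by
    refine (basisMonomials σ R).ext fun m => ?_
    have hm : basisMonomials σ R m = ((Finsupp.toMultiset m).map X).prod := by
      rw [multiset_prod_map_X_eq_monomial, coe_basisMonomials, Finsupp.toMultiset_toFinsupp]
    have hex : ∃ S : Multiset σ, (S.map w).sum = ((Finsupp.toMultiset m).map w).sum := ⟨_, rfl⟩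
    have hn := (basisMonomials τ R).constr_basis R (fun n =>
      if h : ∃ S : Multiset σ, (S.map w).sum = n then Ideal.Quotient.mk I (h.choose.map X).prod
      else 0) ((Finsupp.toMultiset m).map w).sum
    rw [dif_pos hex, hI _ _ hex.choose_spec, coe_basisMonomials] at hn
    rw [hm, LinearMap.comp_apply, AlgHom.toLinearMap_apply, hmon]
    exact hn
  intro p hp
  rw [RingHom.mem_ker] at hp
  have := LinearMap.congr_fun hL p
  rw [LinearMap.comp_apply, AlgHom.toLinearMap_apply, hp, map_zero] at this
  exact Ideal.Quotient.eq_zero_iff_mem.1 this.symm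

/-- A factor `y (k, i)` can absorb `d` units of index from the other factors. -/
theorem exists_transfer_index {κ A : Type*} [CommMonoid A] (len : κ → ℕ) (y : κ × ℕ → A)
    (hy : ∀ k l i j, i < len k → j < len l → y (k, i + 1) * y (l, j) = y (k, i) * y (l, j + 1))
    (d : ℕ) : ∀ (s : Multiset (κ × ℕ)) (k : κ) (i : ℕ), (∀ p ∈ s, p.2 ≤ len p.1) →
      i + d ≤ len k → d ≤ (s.map Prod.snd).sum →
      ∃ s' : Multiset (κ × ℕ), (∀ p ∈ s', p.2 ≤ len p.1) ∧
        s'.map Prod.fst = s.map Prod.fst ∧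
        (s'.map Prod.snd).sum + d = (s.map Prod.snd).sum ∧
        y (k, i) * (s.map y).prod = y (k, i + d) * (s'.map y).prod := by
  induction d with
  | zero => exact fun s k i hs _ _ => ⟨s, hs, rfl, rfl, rfl⟩
  | succ d ih =>
    intro s k i hs hi hd
    obtain ⟨⟨l, j⟩, hp, hj⟩ : ∃ p ∈ s, p.2 ≠ 0 := by
      by_contra! h
      have : (s.map Prod.snd).sum = 0 := Multiset.sum_eq_zero fun x hx => by
        obtain ⟨p, hp, rfl⟩ := Multiset.mem_map.1 hx
        exact h p hp
      omega
    obtain ⟨j, rfl⟩ := Nat.exists_eq_succ_of_ne_zero hj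
    obtain ⟨r, rfl⟩ := Multiset.exists_cons_of_mem hp
    have hlj : j + 1 ≤ len l := hs _ hp
    simp only [Multiset.map_cons, Multiset.sum_cons, Multiset.prod_cons] at hd ⊢
    obtain ⟨s', h1, h2, h3, h4⟩ := ih ((l, j) ::ₘ r) k (i + 1)
      (by
        intro p hp
        rcases Multiset.mem_cons.1 hp with rfl | hp
        · exact Nat.le_of_succ_le hlj
        · exact hs p (Multiset.mem_cons_of_mem hp))
      (by omega) (by simp only [Multiset.map_cons, Multiset.sum_cons]; omega)
    simp only [Multiset.map_cons, Multiset.sum_cons, Multiset.prod_cons] at h2 h3 h4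
    refine ⟨s', h1, h2, by omega, ?_⟩
    rw [show i + (d + 1) = i + 1 + d by omega, ← h4, ← mul_assoc, ← mul_assoc,
      hy k l i j (by omega) (by omega)]

/-- Products of bounded indexed factors depend only on the types of the factors and on the
total index. -/
theorem prod_eq_of_map_fst_eq_of_sum_snd_eq {κ A : Type*} [CommMonoid A] (len : κ → ℕ)
    (y : κ × ℕ → A)
    (hy : ∀ k l i j, i < len k → j < len l → y (k, i + 1) * y (l, j) = y (k, i) * y (l, j + 1))
    (n : ℕ) : ∀ s t : Multiset (κ × ℕ), s.card = n → (∀ p ∈ s, p.2 ≤ len p.1) →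
      (∀ p ∈ t, p.2 ≤ len p.1) → s.map Prod.fst = t.map Prod.fst →
      (s.map Prod.snd).sum = (t.map Prod.snd).sum → (s.map y).prod = (t.map y).prod := by
  induction n with
  | zero =>
    intro s t hs _ _ hst _
    obtain rfl := Multiset.card_eq_zero.1 hs
    have : t = 0 := by simpa using hst.symm
    rw [this]
  | succ n ih =>
    have aux : ∀ (k : κ) (i i' : ℕ) (s t : Multiset (κ × ℕ)), i ≤ i' → s.card = n →
        (∀ p ∈ (k, i) ::ₘ s, p.2 ≤ len p.1) → (∀ p ∈ (k, i') ::ₘ t, p.2 ≤ len p.1) →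
        s.map Prod.fst = t.map Prod.fst →
        i + (s.map Prod.snd).sum = i' + (t.map Prod.snd).sum →
        y (k, i) * (s.map y).prod = y (k, i') * (t.map y).prod := by
      intro k i i' s t hii' hn hs ht hst hsum
      obtain ⟨d, rfl⟩ := Nat.exists_eq_add_of_le hii'
      obtain ⟨s', h1, h2, h3, h4⟩ := exists_transfer_index len y hy d s k i
        (fun p hp => hs p (Multiset.mem_cons_of_mem hp)) (ht _ (Multiset.mem_cons_self _ _))
        (by omega)
      rw [h4, ih s' t _ h1 (fun p hp => ht p (Multiset.mem_cons_of_mem hp)) (h2.trans hst)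
        (by omega)]
      rw [← hn, ← Multiset.card_map Prod.fst s', h2, Multiset.card_map]
    intro s t hn hs ht hst hsum
    obtain ⟨⟨k, i⟩, hki⟩ := Multiset.card_pos_iff_exists_mem.1 (show 0 < s.card by omega)
    obtain ⟨s, rfl⟩ := Multiset.exists_cons_of_mem hki
    have hk : k ∈ t.map Prod.fst := hst ▸ Multiset.mem_map_of_mem Prod.fst hki
    obtain ⟨⟨k', i'⟩, hki', rfl⟩ := Multiset.mem_map.1 hk
    obtain ⟨t, rfl⟩ := Multiset.exists_cons_of_mem hki'
    simp only [Multiset.map_cons, Multiset.sum_cons, Multiset.prod_cons, Multiset.cons_inj_right,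
      Multiset.card_cons, Nat.add_right_cancel_iff] at hst hsum hn ⊢
    have hn' : t.card = n := by
      rw [← hn, ← Multiset.card_map Prod.fst s, hst, Multiset.card_map]
    rcases le_total i i' with h | h
    · exact aux _ i i' s t h hn hs ht hst hsum
    · exact (aux _ i' i t s h hn' ht hs hst.symm hsum.symm).symm

theorem Multiset.pair_eq_pair_imp {α : Type*} {a b c d : α}
    (h : ({a, b} : Multiset α) = {c, d}) : a = c ∧ b = d ∨ a = d ∧ b = c := by
  have : s(a, b) = s(c, d) := by
    rw [Sym2.eq_iff]
    simp only [Multiset.insert_eq_cons, Multiset.cons_eq_cons] at h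
    grind [Multiset.singleton_inj, Multiset.singleton_eq_cons_iff]
  simpa using this

/-- A difference of quadratic monomials separated by a symmetric relation `P` lies outside the
ideal generated by differences of quadratic monomials not separated by `P`. -/
theorem notMem_span_of_separates {σ R : Type*} [CommRing R] [Nontrivial R]
    (P : σ → σ → Prop) (hP : ∀ u v, P u v → P v u) (G : Set (MvPolynomial σ R))
    (hG : ∀ g ∈ G, ∃ u v u' v', g = X u * X v - X u' * X v' ∧ (P u v ↔ P u' v'))
    {a b a' b' : σ} (hab : ¬(P a b ↔ P a' b')) :
    X a * X b - X a' * X b' ∉ Ideal.span G := by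
  classical
  let c : (σ →₀ ℕ) → R := fun m =>
    if ∃ u v, P u v ∧ Finsupp.toMultiset m = {u, v} then 1 else 0
  let φ : MvPolynomial σ R →ₗ[R] R := (basisMonomials σ R).constr R c
  have hφ : ∀ S : Multiset σ, φ (S.map X).prod =
      if ∃ u v, P u v ∧ S = {u, v} then 1 else 0 := by
    intro S
    have := (basisMonomials σ R).constr_basis R c (Multiset.toFinsupp S)
    rw [coe_basisMonomials] at this
    rw [multiset_prod_map_X_eq_monomial]
    refine this.trans ?_
    simp only [c, Multiset.toFinsupp_toMultiset]
  have hquad : ∀ u v, φ (X u * X v) = if P u v then 1 else 0 := by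
    intro u v
    have := hφ {u, v}
    simp only [Multiset.insert_eq_cons, Multiset.map_cons, Multiset.map_singleton,
      Multiset.prod_cons, Multiset.prod_singleton] at this
    rw [this]
    congr 1
    refine propext ⟨?_, fun h => ⟨u, v, h, rfl⟩⟩
    rintro ⟨u', v', h, he⟩
    rcases Multiset.pair_eq_pair_imp he with ⟨rfl, rfl⟩ | ⟨rfl, rfl⟩
    · exact h
    · exact hP _ _ h
  have hhigh : ∀ (S : Multiset σ) (u v : σ), S ≠ 0 → φ ((S.map X).prod * (X u * X v)) = 0 := by
    intro S u v hS
    have := hφ (S + {u, v})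
    simp only [Multiset.insert_eq_cons, Multiset.map_add, Multiset.prod_add, Multiset.map_cons,
      Multiset.map_singleton, Multiset.prod_cons, Multiset.prod_singleton] at this
    rw [this, if_neg]
    rintro ⟨u', v', -, he⟩
    have := congrArg Multiset.card he
    simp at this
    exact hS this
  have hspan : ∀ p ∈ Ideal.span G, φ p = 0 := by
    intro p hp
    induction hp using Submodule.closure_induction with
    | zero => exact map_zero φ
    | add x y _ _ hx hy => rw [map_add, hx, hy, add_zero]
    | smul_mem r g hg =>
      obtain ⟨u, v, u', v', rfl, h⟩ := hG g hg
      have hzero : φ ∘ₗ LinearMap.mulRight R (X u * X v - X u' * X v') = 0 := by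
        refine (basisMonomials σ R).ext fun m => ?_
        have hm : basisMonomials σ R m = ((Finsupp.toMultiset m).map X).prod := by
          rw [multiset_prod_map_X_eq_monomial, coe_basisMonomials, Finsupp.toMultiset_toFinsupp]
        rw [hm, LinearMap.comp_apply, LinearMap.mulRight_apply, LinearMap.zero_apply, mul_sub,
          map_sub]
        rcases eq_or_ne (Finsupp.toMultiset m) 0 with h0 | h0
        · simp only [h0, Multiset.map_zero, Multiset.prod_zero, one_mul, hquad, h, sub_self]
        · rw [hhigh _ _ _ h0, hhigh _ _ _ h0, sub_self]
      exact LinearMap.congr_fun hzero r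
  intro hmem
  have := hspan _ hmem
  rw [map_sub, hquad, hquad] at this
  by_cases h1 : P a b <;> by_cases h2 : P a' b' <;> simp_all

/-- The largest index of each of the three families of variables `T`, `X`, `Y`. -/
def scrollLen (μ1 μ2 : ℕ) : Fin 3 → ℕ := ![1, μ1, μ2]

/-- The variables of `PBig` by family and index (junk value `0` out of range). -/
def scrollVar (K : Type) [Field K] (μ1 μ2 : ℕ) (p : Fin 3 × ℕ) : PBig K μ1 μ2 :=
  ![if h : p.2 < 2 then X (Sum.inl ⟨p.2, h⟩) else 0, Xn K μ1 μ2 p.2, Yn K μ1 μ2 p.2] p.1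

/-- The family and index of a variable of `PBig`. -/
def scrollPos (μ1 μ2 : ℕ) : Fin 2 ⊕ (Fin (μ1 + 1) ⊕ Fin (μ2 + 1)) → Fin 3 × ℕ :=
  Sum.elim (fun i => (0, (i : ℕ))) (Sum.elim (fun i => (1, (i : ℕ))) (fun i => (2, (i : ℕ))))

theorem scrollVar_scrollPos (K : Type) [Field K] (μ1 μ2 : ℕ)
    (u : Fin 2 ⊕ (Fin (μ1 + 1) ⊕ Fin (μ2 + 1))) :
    scrollVar K μ1 μ2 (scrollPos μ1 μ2 u) = X u := by
  rcases u with i | i | i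
  · exact dif_pos i.is_lt
  · exact dif_pos i.is_lt
  · exact dif_pos i.is_lt

theorem scrollPos_le (μ1 μ2 : ℕ) (u : Fin 2 ⊕ (Fin (μ1 + 1) ⊕ Fin (μ2 + 1))) :
    (scrollPos μ1 μ2 u).2 ≤ scrollLen μ1 μ2 (scrollPos μ1 μ2 u).1 := by
  rcases u with i | i | i <;> simp [scrollLen, scrollPos] <;> omega

theorem exists_scrollPos_eq (μ1 μ2 : ℕ) (k : Fin 3) (n : ℕ) (h : n ≤ scrollLen μ1 μ2 k) :
    ∃ u, scrollPos μ1 μ2 u = (k, n) := by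
  fin_cases k
  · exact ⟨Sum.inl ⟨n, Nat.lt_succ_of_le h⟩, rfl⟩
  · exact ⟨Sum.inr (Sum.inl ⟨n, Nat.lt_succ_of_le h⟩), rfl⟩
  · exact ⟨Sum.inr (Sum.inr ⟨n, Nat.lt_succ_of_le h⟩), rfl⟩

/-- The generators are the `2 × 2` minors of the scroll matrix with blocks `T`, `X`, `Y`. -/
theorem mem_genSet_iff (K : Type) [Field K] (μ1 μ2 : ℕ) (f : PBig K μ1 μ2) :
    f ∈ genSet K μ1 μ2 ↔ ∃ (k l : Fin 3) (i j : ℕ), i < scrollLen μ1 μ2 k ∧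
      j < scrollLen μ1 μ2 l ∧ (k < l ∨ k = l ∧ i + 1 ≤ j) ∧
      f = scrollVar K μ1 μ2 (k, i + 1) * scrollVar K μ1 μ2 (l, j) -
        scrollVar K μ1 μ2 (k, i) * scrollVar K μ1 μ2 (l, j + 1) := by
  constructor
  · rintro ((((⟨i, h1, h2, rfl⟩ | ⟨i, h1, h2, rfl⟩) | ⟨i, j, h1, h2, h3, rfl⟩) |
      ⟨i, j, h1, h2, h3, rfl⟩) | ⟨i, j, h1, h2, h3, rfl⟩) <;>
      obtain ⟨i, rfl⟩ := Nat.exists_eq_add_of_le' h1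
    · exact ⟨0, 1, 0, i, one_pos, h2, by simp, rfl⟩
    · exact ⟨0, 2, 0, i, one_pos, h2, by simp, rfl⟩
    · exact ⟨1, 1, i, j, show i < μ1 by omega, h3, .inr ⟨rfl, h2⟩, rfl⟩
    · exact ⟨2, 2, i, j, show i < μ2 by omega, h3, .inr ⟨rfl, h2⟩, rfl⟩
    · exact ⟨1, 2, i, j, h2, h3, by simp, rfl⟩
  · rintro ⟨k, l, i, j, hi, hj, hkl, rfl⟩
    fin_cases k <;> fin_cases l <;> simp [scrollLen] at hi hj hkl
    · omega
    · subst hi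
      exact .inl (.inl (.inl (.inl ⟨j + 1, by omega, hj, rfl⟩)))
    · subst hi
      exact .inl (.inl (.inl (.inr ⟨j + 1, by omega, hj, rfl⟩)))
    · exact .inl (.inl (.inr ⟨i + 1, j, by omega, hkl, hj, rfl⟩))
    · exact .inr ⟨i + 1, j, by omega, hi, hj, rfl⟩
    · exact .inl (.inr ⟨i + 1, j, by omega, hkl, hj, rfl⟩)

/-- The exponents of the monomial to which `Phi'Map` sends a variable. -/
def scrollExponent (μ1 μ2 : ℕ) : Fin 2 ⊕ (Fin (μ1 + 1) ⊕ Fin (μ2 + 1)) → Fin 2 ⊕ Fin 2 →₀ ℕ :=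
  Sum.elim (fun i => Finsupp.single (Sum.inl i) 1)
    (Sum.elim
      (fun i => Finsupp.single (Sum.inl 0) (μ1 - (i : ℕ)) + Finsupp.single (Sum.inl 1) (i : ℕ) +
        Finsupp.single (Sum.inr 0) 1)
      (fun i => Finsupp.single (Sum.inl 0) (μ2 - (i : ℕ)) + Finsupp.single (Sum.inl 1) (i : ℕ) +
        Finsupp.single (Sum.inr 1) 1))

theorem Phi'Map_X (K : Type) [Field K] (μ1 μ2 : ℕ)
    (u : Fin 2 ⊕ (Fin (μ1 + 1) ⊕ Fin (μ2 + 1))) :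
    Phi'Map K μ1 μ2 (X u) = monomial (scrollExponent μ1 μ2 u) 1 := by
  rw [Phi'Map, aeval_X]
  rcases u with i | i | i
  · rfl
  · simp [scrollExponent, X, monomial_mul, monomial_pow, -Finsupp.single_tsub]
  · simp [scrollExponent, X, monomial_mul, monomial_pow, -Finsupp.single_tsub]

theorem sum_scrollExponent (μ1 μ2 : ℕ)
    (S : Multiset (Fin 2 ⊕ (Fin (μ1 + 1) ⊕ Fin (μ2 + 1)))) :
    (S.map (scrollExponent μ1 μ2)).sum (Sum.inr 0) =
        ((S.map (scrollPos μ1 μ2)).map Prod.fst).count 1 ∧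
      (S.map (scrollExponent μ1 μ2)).sum (Sum.inr 1) =
        ((S.map (scrollPos μ1 μ2)).map Prod.fst).count 2 ∧
      (S.map (scrollExponent μ1 μ2)).sum (Sum.inl 1) =
        ((S.map (scrollPos μ1 μ2)).map Prod.snd).sum ∧
      (S.map (scrollExponent μ1 μ2)).sum (Sum.inl 0) +
          (S.map (scrollExponent μ1 μ2)).sum (Sum.inl 1) =
        ((S.map (scrollPos μ1 μ2)).map Prod.fst).count 0 +
          μ1 * ((S.map (scrollPos μ1 μ2)).map Prod.fst).count 1 +
          μ2 * ((S.map (scrollPos μ1 μ2)).map Prod.fst).count 2 := by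
  induction S using Multiset.induction with
  | empty => simp
  | cons u S ih =>
    simp only [Multiset.map_cons, Multiset.sum_cons, Multiset.count_cons, Finsupp.add_apply]
    generalize (S.map (scrollExponent μ1 μ2)).sum = E at ih ⊢
    generalize (S.map (scrollPos μ1 μ2)).map Prod.fst = F at ih ⊢
    generalize ((S.map (scrollPos μ1 μ2)).map Prod.snd).sum = n at ih ⊢
    obtain ⟨h1, h2, h3, h4⟩ := ih
    rw [h1, h2]
    rcases u with i | i | i
    · fin_cases i <;> simp [scrollExponent, scrollPos] <;> omega
    · have := i.is_le
      simp [scrollExponent, scrollPos, mul_add]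
      omega
    · have := i.is_le
      simp [scrollExponent, scrollPos, mul_add]
      omega

theorem scroll_map_fst_eq_and_sum_snd_eq (μ1 μ2 : ℕ)
    {S T : Multiset (Fin 2 ⊕ (Fin (μ1 + 1) ⊕ Fin (μ2 + 1)))}
    (h : (S.map (scrollExponent μ1 μ2)).sum = (T.map (scrollExponent μ1 μ2)).sum) :
    (S.map (scrollPos μ1 μ2)).map Prod.fst = (T.map (scrollPos μ1 μ2)).map Prod.fst ∧
      ((S.map (scrollPos μ1 μ2)).map Prod.snd).sum =
        ((T.map (scrollPos μ1 μ2)).map Prod.snd).sum := by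
  obtain ⟨s1, s2, s3, s4⟩ := sum_scrollExponent μ1 μ2 S
  obtain ⟨t1, t2, t3, t4⟩ := sum_scrollExponent μ1 μ2 T
  rw [h] at s1 s2 s3 s4
  rw [s1] at t1
  rw [s2] at t2
  rw [s4, t1, t2] at t4
  refine ⟨Multiset.ext' fun k => ?_, s3.symm.trans t3⟩
  fin_cases k
  · exact Nat.add_right_cancel (Nat.add_right_cancel t4)
  · exact t1
  · exact t2

theorem genSet_minor_mem_span (K : Type) [Field K] (μ1 μ2 : ℕ) (k l : Fin 3) (i j : ℕ)
    (hi : i < scrollLen μ1 μ2 k) (hj : j < scrollLen μ1 μ2 l) :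
    scrollVar K μ1 μ2 (k, i + 1) * scrollVar K μ1 μ2 (l, j) -
      scrollVar K μ1 μ2 (k, i) * scrollVar K μ1 μ2 (l, j + 1) ∈
        Ideal.span (genSet K μ1 μ2) := by
  have key : ∀ (k l : Fin 3) (i j : ℕ), i < scrollLen μ1 μ2 k → j < scrollLen μ1 μ2 l →
      (k < l ∨ k = l ∧ i + 1 ≤ j) →
      scrollVar K μ1 μ2 (k, i + 1) * scrollVar K μ1 μ2 (l, j) -
        scrollVar K μ1 μ2 (k, i) * scrollVar K μ1 μ2 (l, j + 1) ∈
          Ideal.span (genSet K μ1 μ2) := fun k l i j hi hj h =>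
    Ideal.subset_span ((mem_genSet_iff K μ1 μ2 _).2 ⟨k, l, i, j, hi, hj, h, rfl⟩)
  have hcases : (k < l ∨ k = l ∧ i + 1 ≤ j) ∨ (l < k ∨ l = k ∧ j + 1 ≤ i) ∨ k = l ∧ i = j := by
    omega
  rcases hcases with h | h | ⟨rfl, rfl⟩
  · exact key k l i j hi hj h
  · rw [← neg_mem_iff]
    convert key l k j i hj hi h using 1
    ring
  · rw [mul_comm, sub_self]
    exact zero_mem _

theorem Phi'Map_scrollVar (K : Type) [Field K] (μ1 μ2 : ℕ) (k : Fin 3) (i : ℕ)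
    (hi : i ≤ scrollLen μ1 μ2 k) :
    Phi'Map K μ1 μ2 (scrollVar K μ1 μ2 (k, i)) =
      X (Sum.inl 0) ^ (scrollLen μ1 μ2 k - i) * X (Sum.inl 1) ^ i *
        ![1, X (Sum.inr 0), X (Sum.inr 1)] k := by
  obtain ⟨u, hu⟩ := exists_scrollPos_eq μ1 μ2 k i hi
  rw [← hu, scrollVar_scrollPos, Phi'Map, aeval_X]
  rcases u with j | j | j <;> obtain ⟨rfl, rfl⟩ := Prod.mk.inj hu
  · fin_cases j <;> simp [scrollLen]
  · rfl
  · rfl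

theorem span_genSet_le_ker (K : Type) [Field K] (μ1 μ2 : ℕ) :
    Ideal.span (genSet K μ1 μ2) ≤ RingHom.ker (Phi'Map K μ1 μ2) := by
  rw [Ideal.span_le]
  intro f hf
  obtain ⟨k, l, i, j, hi, hj, -, rfl⟩ := (mem_genSet_iff K μ1 μ2 f).1 hf
  rw [SetLike.mem_coe, RingHom.mem_ker, map_sub, map_mul, map_mul,
    Phi'Map_scrollVar K μ1 μ2 k (i + 1) hi, Phi'Map_scrollVar K μ1 μ2 k _ hi.le,
    Phi'Map_scrollVar K μ1 μ2 l (j + 1) hj, Phi'Map_scrollVar K μ1 μ2 l _ hj.le]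
  obtain ⟨a, ha⟩ := Nat.exists_eq_add_of_le (show i + 1 ≤ _ from hi)
  obtain ⟨b, hb⟩ := Nat.exists_eq_add_of_le (show j + 1 ≤ _ from hj)
  rw [show scrollLen μ1 μ2 k - i = a + 1 by omega, show scrollLen μ1 μ2 k - (i + 1) = a by omega,
    show scrollLen μ1 μ2 l - j = b + 1 by omega, show scrollLen μ1 μ2 l - (j + 1) = b by omega]
  ring

theorem ker_le_span_genSet (K : Type) [Field K] (μ1 μ2 : ℕ) :
    RingHom.ker (Phi'Map K μ1 μ2) ≤ Ideal.span (genSet K μ1 μ2) := by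
  refine ker_le_of_monomial_congr _ (scrollExponent μ1 μ2) (Phi'Map_X K μ1 μ2) _ fun S T h => ?_
  obtain ⟨hfst, hsnd⟩ := scroll_map_fst_eq_and_sum_snd_eq μ1 μ2 h
  have hbound : ∀ S : Multiset (Fin 2 ⊕ (Fin (μ1 + 1) ⊕ Fin (μ2 + 1))),
      ∀ p ∈ S.map (scrollPos μ1 μ2), p.2 ≤ scrollLen μ1 μ2 p.1 := by
    intro S p hp
    obtain ⟨u, -, rfl⟩ := Multiset.mem_map.1 hp
    exact scrollPos_le μ1 μ2 u
  have := prod_eq_of_map_fst_eq_of_sum_snd_eq (scrollLen μ1 μ2)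
    (fun p => Ideal.Quotient.mk (Ideal.span (genSet K μ1 μ2)) (scrollVar K μ1 μ2 p))
    (fun k l i j hi hj => by
      rw [← map_mul, ← map_mul]
      exact Ideal.Quotient.eq.2 (genSet_minor_mem_span K μ1 μ2 k l i j hi hj))
    _ (S.map (scrollPos μ1 μ2)) (T.map (scrollPos μ1 μ2)) rfl (hbound S) (hbound T) hfst hsnd
  simpa only [Multiset.map_map, Function.comp_def, scrollVar_scrollPos, map_multiset_prod]
    using this

/-- The pairs of positions of total index `i + j + 1` in the families `k`, `l` that are at least
as balanced as `(k, i + 1)`, `(l, j)`. -/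
def scrollPairing (k l : Fin 3) (i j : ℕ) (p q : Fin 3 × ℕ) : Prop :=
  p.1 = k ∧ q.1 = l ∧ p.2 + q.2 = i + 1 + j ∧ i + 1 ≤ p.2 ∧ (k = l → i + 1 ≤ q.2)

theorem notMem_span_genSet_diff (K : Type) [Field K] (μ1 μ2 : ℕ) (f : PBig K μ1 μ2)
    (hf : f ∈ genSet K μ1 μ2) : f ∉ Ideal.span (genSet K μ1 μ2 \ {f}) := by
  obtain ⟨k, l, i, j, hi, hj, hkl, hfeq⟩ := (mem_genSet_iff K μ1 μ2 f).1 hf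
  obtain ⟨a, ha⟩ := exists_scrollPos_eq μ1 μ2 k (i + 1) hi
  obtain ⟨b, hb⟩ := exists_scrollPos_eq μ1 μ2 l j hj.le
  obtain ⟨a', ha'⟩ := exists_scrollPos_eq μ1 μ2 k i hi.le
  obtain ⟨b', hb'⟩ := exists_scrollPos_eq μ1 μ2 l (j + 1) hj
  have hfX : f = X a * X b - X a' * X b' := by
    simp only [← scrollVar_scrollPos, ha, hb, ha', hb', hfeq]
  have hmain := notMem_span_of_separates (R := K)
    (fun u v => scrollPairing k l i j (scrollPos μ1 μ2 u) (scrollPos μ1 μ2 v) ∨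
      scrollPairing k l i j (scrollPos μ1 μ2 v) (scrollPos μ1 μ2 u))
    (fun _ _ => Or.symm) (genSet K μ1 μ2 \ {f}) ?_ (a := a) (b := b) (a' := a') (b' := b') ?_
  · rwa [← hfX] at hmain
  · rintro g ⟨hg, hgf⟩
    obtain ⟨k', l', i', j', hi', hj', hkl', hgeq⟩ := (mem_genSet_iff K μ1 μ2 g).1 hg
    have hne : ¬(k' = k ∧ l' = l ∧ i' = i ∧ j' = j) := by
      rintro ⟨rfl, rfl, rfl, rfl⟩
      exact hgf (hgeq.trans hfeq.symm)
    obtain ⟨u, hu⟩ := exists_scrollPos_eq μ1 μ2 k' (i' + 1) hi'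
    obtain ⟨v, hv⟩ := exists_scrollPos_eq μ1 μ2 l' j' hj'.le
    obtain ⟨u', hu'⟩ := exists_scrollPos_eq μ1 μ2 k' i' hi'.le
    obtain ⟨v', hv'⟩ := exists_scrollPos_eq μ1 μ2 l' (j' + 1) hj'
    refine ⟨u, v, u', v', ?_, ?_⟩
    · simp only [← scrollVar_scrollPos, hu, hv, hu', hv', hgeq]
    · simp only [hu, hv, hu', hv', scrollPairing]
      clear hgf hgeq hg hfX hfeq hf hu hv hu' hv' ha ha' hb hb' hi hi' hj hj'
      omega
  · simp only [ha, hb, ha', hb', scrollPairing]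
    rcases hkl with h | ⟨rfl, h⟩
    · have := h.ne
      grind
    · grind

theorem stmt3 (K : Type) [Field K] (μ1 μ2 : ℕ) (hμ12 : μ1 ≤ μ2) :
    RingHom.ker (Phi'Map K μ1 μ2) = Ideal.span (genSet K μ1 μ2) ∧
    ∀ f ∈ genSet K μ1 μ2, f ∉ Ideal.span (genSet K μ1 μ2 \ {f}) := by
  exact ⟨le_antisymm (ker_le_span_genSet K μ1 μ2) (span_genSet_le_ker K μ1 μ2),
    notMem_span_genSet_diff K μ1 μ2⟩
end
end

section
/- Suppose A ∈ K[T0,T1,X_0,…,X_{μ1},Y_0,…,Y_{μ2}] is trihomogeneous of degree (i,j,k) with k ≥ 1, and ε(A) = α·q for some nonzero homogeneous q ∈ K[T0,T1] of degree i + (j+1)·μ1 + k·μ2 − d. Then there exists B ∈ K[T0,T1,X_0,…,X_{μ1},Y_0,…,Y_{μ2}], trihomogeneous of degree (i,j+1,k−1), such that A − B lies in the kernel of Φ. -/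
open MvPolynomial

noncomputable section

/-- The map `ε`, fixing `T0,T1`, with `X_i ↦ T0^{μ1-i}·T1^i` and
`Y_i ↦ T0^{μ2-i}·T1^i`. -/
def epsMap (K : Type) [Field K] (μ1 μ2 : ℕ) :
    PBig K μ1 μ2 →ₐ[K] PT K :=
  aeval (Sum.elim X
    (Sum.elim
      (fun i => X 0 ^ (μ1 - (i : ℕ)) * X 1 ^ (i : ℕ))
      (fun i => X 0 ^ (μ2 - (i : ℕ)) * X 1 ^ (i : ℕ))))

/-- Weight function giving degree in the variables `T0,T1`. -/
def wT (μ1 μ2 : ℕ) : Fin 2 ⊕ (Fin (μ1+1) ⊕ Fin (μ2+1)) → ℕ :=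
  Sum.elim (fun _ => 1) (fun _ => 0)

/-- `F` is trihomogeneous of degree `(i,j,k)`. -/
def TriHom (K : Type) [Field K] (μ1 μ2 : ℕ) (F : PBig K μ1 μ2) (i j k : ℕ) : Prop :=
  F.IsWeightedHomogeneous (wT μ1 μ2) i ∧
  F.IsWeightedHomogeneous (wX μ1 μ2) j ∧
  F.IsWeightedHomogeneous (wY μ1 μ2) k

/-- `Φ` of a monomial is its image under `ε` times the powers of `α`, `β`, `s` given by its
degrees in the `X`'s and the `Y`'s. -/
theorem PhiMap_monomial_one (K : Type) [Field K] (μ1 μ2 : ℕ) (α β : PT K)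
    (m : Fin 2 ⊕ (Fin (μ1 + 1) ⊕ Fin (μ2 + 1)) →₀ ℕ) :
    PhiMap K μ1 μ2 α β (monomial m 1) =
      rename Sum.inl (epsMap K μ1 μ2 (monomial m 1)) *
        ((rename Sum.inl α * X (Sum.inr ())) ^ Finsupp.weight (wX μ1 μ2) m *
          (rename Sum.inl β * X (Sum.inr ())) ^ Finsupp.weight (wY μ1 μ2) m) := by
  induction m using Finsupp.induction_linear with
  | zero => simp
  | add f g hf hg =>
    have hfg : (monomial (f + g) (1 : K)) = monomial f 1 * monomial g 1 := by
      rw [monomial_mul, one_mul]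
    rw [hfg, map_mul, hf, hg, map_mul, map_mul, map_add, map_add, pow_add, pow_add]
    ring
  | single v n =>
    rw [← X_pow_eq_monomial, map_pow, map_pow, map_pow, Finsupp.weight_single,
      Finsupp.weight_single]
    rcases v with v | v | v <;>
      simp [PhiMap, epsMap, wX, wY] <;> ring

/-- On trihomogeneous polynomials, `Φ` is determined by `ε`. -/
theorem TriHom.PhiMap_eq {K : Type} [Field K] {μ1 μ2 : ℕ} (α β : PT K) {F : PBig K μ1 μ2}
    {i j k : ℕ} (hF : TriHom K μ1 μ2 F i j k) :
    PhiMap K μ1 μ2 α β F =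
      rename Sum.inl (epsMap K μ1 μ2 F) *
        ((rename Sum.inl α * X (Sum.inr ())) ^ j *
          (rename Sum.inl β * X (Sum.inr ())) ^ k) := by
  rw [F.as_sum, map_sum, map_sum, map_sum, Finset.sum_mul]
  refine Finset.sum_congr rfl fun m hm => ?_
  have hm := mem_support_iff.mp hm
  have hc : monomial m (coeff m F) = coeff m F • monomial m (1 : K) := by
    rw [smul_monomial, smul_eq_mul, mul_one]
  rw [hc, map_smul, map_smul, map_smul, PhiMap_monomial_one, hF.2.1 hm, hF.2.2 hm, smul_mul_assoc]

theorem epsMap_monomial_one_isHomogeneous (K : Type) [Field K] (μ1 μ2 : ℕ)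
    (m : Fin 2 ⊕ (Fin (μ1 + 1) ⊕ Fin (μ2 + 1)) →₀ ℕ) :
    (epsMap K μ1 μ2 (monomial m 1)).IsHomogeneous
      (Finsupp.weight (wT μ1 μ2) m + Finsupp.weight (wX μ1 μ2) m * μ1 +
        Finsupp.weight (wY μ1 μ2) m * μ2) := by
  induction m using Finsupp.induction_linear with
  | zero => simpa using isHomogeneous_one (Fin 2) K
  | add f g hf hg =>
    have hfg : (monomial (f + g) (1 : K)) = monomial f 1 * monomial g 1 := by
      rw [monomial_mul, one_mul]
    rw [hfg, map_mul]
    convert hf.mul hg using 1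
    simp only [map_add]
    ring
  | single v n =>
    have hX (μ : ℕ) (c : Fin (μ + 1)) :
        (X 0 ^ (μ - (c : ℕ)) * X 1 ^ (c : ℕ) : PT K).IsHomogeneous μ := by
      convert ((isHomogeneous_X K (0 : Fin 2)).pow (μ - c)).mul
        ((isHomogeneous_X K (1 : Fin 2)).pow c) using 1
      have := c.is_lt
      omega
    rw [← X_pow_eq_monomial, map_pow]
    simp only [Finsupp.weight_single]
    rcases v with v | v | v
    · simpa [epsMap, wT, wX, wY] using (isHomogeneous_X K v).pow n
    · simpa [epsMap, wT, wX, wY, mul_comm] using (hX μ1 v).pow n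
    · simpa [epsMap, wT, wX, wY, mul_comm] using (hX μ2 v).pow n

theorem TriHom.epsMap_isHomogeneous {K : Type} [Field K] {μ1 μ2 : ℕ} {F : PBig K μ1 μ2}
    {i j k : ℕ} (hF : TriHom K μ1 μ2 F i j k) :
    (epsMap K μ1 μ2 F).IsHomogeneous (i + j * μ1 + k * μ2) := by
  rw [F.as_sum, map_sum]
  refine IsHomogeneous.sum _ _ _ fun m hm => ?_
  have hm := mem_support_iff.mp hm
  have hc : monomial m (coeff m F) = C (coeff m F) * monomial m (1 : K) := by
    rw [C_mul_monomial, mul_one]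
  have h := epsMap_monomial_one_isHomogeneous K μ1 μ2 m
  rw [hF.1 hm, hF.2.1 hm, hF.2.2 hm] at h
  rw [hc, map_mul, algHom_C, algebraMap_eq]
  exact h.C_mul _

theorem TriHom.mul {K : Type} [Field K] {μ1 μ2 : ℕ} {F G : PBig K μ1 μ2} {i j k i' j' k' : ℕ}
    (hF : TriHom K μ1 μ2 F i j k) (hG : TriHom K μ1 μ2 G i' j' k') :
    TriHom K μ1 μ2 (F * G) (i + i') (j + j') (k + k') :=
  ⟨hF.1.mul hG.1, hF.2.1.mul hG.2.1, hF.2.2.mul hG.2.2⟩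

theorem triHom_X (K : Type) [Field K] (μ1 μ2 : ℕ)
    (v : Fin 2 ⊕ (Fin (μ1 + 1) ⊕ Fin (μ2 + 1))) :
    TriHom K μ1 μ2 (X v) (wT μ1 μ2 v) (wX μ1 μ2 v) (wY μ1 μ2 v) :=
  ⟨isWeightedHomogeneous_X _ _ _, isWeightedHomogeneous_X _ _ _, isWeightedHomogeneous_X _ _ _⟩

/-- A monomial `T0 ^ a * T1 ^ b` of degree at least `μ` has a divisor `T0 ^ (μ - c) * T1 ^ c`. -/
theorem exists_split_exponent {a b μ n : ℕ} (h : a + b = n + μ) :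
    ∃ c : Fin (μ + 1), ∃ a' b', a' + b' = n ∧ a = a' + (μ - (c : ℕ)) ∧ b = b' + (c : ℕ) := by
  refine ⟨⟨min b μ, by omega⟩, a - (μ - min b μ), b - min b μ, ?_, ?_, ?_⟩ <;>
    grind

/-- Every monomial in `T0, T1` of degree `i + j μ1 + k μ2` is the image under `ε` of a
trihomogeneous polynomial of degree `(i,j,k)`. -/
theorem exists_triHom_epsMap_eq_X_pow (K : Type) [Field K] (μ1 μ2 : ℕ) (i j k a b : ℕ)
    (h : a + b = i + j * μ1 + k * μ2) :
    ∃ B : PBig K μ1 μ2, TriHom K μ1 μ2 B i j k ∧ epsMap K μ1 μ2 B = X 0 ^ a * X 1 ^ b := by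
  induction k generalizing a b with
  | zero =>
    induction j generalizing a b with
    | zero =>
      have hab : a + b = i := by simpa using h
      subst hab
      refine ⟨X (Sum.inl 0) ^ a * X (Sum.inl 1) ^ b, ⟨?_, ?_, ?_⟩, by simp [epsMap]⟩
      · simpa [wT] using ((isWeightedHomogeneous_X K (wT μ1 μ2) (Sum.inl 0)).pow a).mul
          ((isWeightedHomogeneous_X K (wT μ1 μ2) (Sum.inl 1)).pow b)
      · simpa [wX] using ((isWeightedHomogeneous_X K (wX μ1 μ2) (Sum.inl 0)).pow a).mul
          ((isWeightedHomogeneous_X K (wX μ1 μ2) (Sum.inl 1)).pow b)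
      · simpa [wY] using ((isWeightedHomogeneous_X K (wY μ1 μ2) (Sum.inl 0)).pow a).mul
          ((isWeightedHomogeneous_X K (wY μ1 μ2) (Sum.inl 1)).pow b)
    | succ j ih =>
      obtain ⟨c, a', b', hn, rfl, rfl⟩ :=
        exists_split_exponent (μ := μ1) (n := i + j * μ1 + 0 * μ2) (h.trans (by ring))
      obtain ⟨B, hB, hεB⟩ := ih a' b' hn
      refine ⟨B * X (Sum.inr (Sum.inl c)), hB.mul (triHom_X K μ1 μ2 _), ?_⟩
      rw [map_mul, hεB, pow_add, pow_add]
      simp only [epsMap, aeval_X, Sum.elim_inr, Sum.elim_inl]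
      ring
  | succ k ih =>
    obtain ⟨c, a', b', hn, rfl, rfl⟩ :=
      exists_split_exponent (μ := μ2) (n := i + j * μ1 + k * μ2) (h.trans (by ring))
    obtain ⟨B, hB, hεB⟩ := ih a' b' hn
    refine ⟨B * X (Sum.inr (Sum.inr c)), hB.mul (triHom_X K μ1 μ2 _), ?_⟩
    rw [map_mul, hεB, pow_add, pow_add]
    simp only [epsMap, aeval_X, Sum.elim_inr]
    ring

/-- `ε` maps the trihomogeneous polynomials of degree `(i,j,k)` onto the homogeneous
polynomials of degree `i + j μ1 + k μ2`. -/
theorem exists_triHom_epsMap_eq {K : Type} [Field K] {μ1 μ2 i j k : ℕ} {p : PT K}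
    (hp : p.IsHomogeneous (i + j * μ1 + k * μ2)) :
    ∃ B : PBig K μ1 μ2, TriHom K μ1 μ2 B i j k ∧ epsMap K μ1 μ2 B = p := by
  have key (m : Fin 2 →₀ ℕ) : ∃ B : PBig K μ1 μ2, TriHom K μ1 μ2 B i j k ∧
      epsMap K μ1 μ2 B = monomial m (coeff m p) := by
    by_cases hm : coeff m p = 0
    · exact ⟨0, ⟨isWeightedHomogeneous_zero _ _ _, isWeightedHomogeneous_zero _ _ _,
        isWeightedHomogeneous_zero _ _ _⟩, by simp [hm]⟩
    · have hdeg : m 0 + m 1 = i + j * μ1 + k * μ2 := by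
        rw [← hp hm, Finsupp.weight_apply, Finsupp.sum_fintype _ _ (by simp), Fin.sum_univ_two]
        simp
      obtain ⟨B, hB, hεB⟩ := exists_triHom_epsMap_eq_X_pow K μ1 μ2 i j k _ _ hdeg
      have hC (w : Fin 2 ⊕ (Fin (μ1 + 1) ⊕ Fin (μ2 + 1)) → ℕ) {n : ℕ}
          (h : B.IsWeightedHomogeneous w n) :
          (C (coeff m p) * B).IsWeightedHomogeneous w n := by
        simpa using (isWeightedHomogeneous_C w (coeff m p)).mul h
      refine ⟨C (coeff m p) * B, ⟨hC _ hB.1, hC _ hB.2.1, hC _ hB.2.2⟩, ?_⟩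
      rw [map_mul, hεB, algHom_C, algebraMap_eq, monomial_eq, Finsupp.prod_fintype _ _ (by simp),
        Fin.prod_univ_two]
  choose B hB hεB using key
  refine ⟨∑ m ∈ p.support, B m, ⟨IsWeightedHomogeneous.sum _ _ _ fun m _ => (hB m).1,
    IsWeightedHomogeneous.sum _ _ _ fun m _ => (hB m).2.1,
    IsWeightedHomogeneous.sum _ _ _ fun m _ => (hB m).2.2⟩, ?_⟩
  rw [map_sum, Finset.sum_congr rfl fun m _ => hεB m, ← p.as_sum]

theorem stmt4 (K : Type) [Field K] (d μ1 μ2 : ℕ) (hμ12 : μ1 ≤ μ2)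
    (hd : 2 * (μ1 + μ2) ≤ d)
    (α β : PT K) (hα0 : α ≠ 0) (hβ0 : β ≠ 0)
    (hα : α.IsHomogeneous (d - μ1)) (hβ : β.IsHomogeneous (d - μ2))
    (hcop : ∀ c : PT K, c ∣ α → c ∣ β → IsUnit c)
    (i j k : ℕ) (hk : 1 ≤ k)
    (A : PBig K μ1 μ2) (hA : TriHom K μ1 μ2 A i j k)
    (q : PT K) (hq0 : q ≠ 0)
    (hqhom : q.IsHomogeneous (i + (j+1) * μ1 + k * μ2 - d))
    (hεA : epsMap K μ1 μ2 A = α * q) :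
    ∃ B : PBig K μ1 μ2, TriHom K μ1 μ2 B i (j+1) (k-1) ∧
      PhiMap K μ1 μ2 α β (A - B) = 0 := by
  obtain ⟨k, rfl⟩ := Nat.exists_eq_add_of_le' hk
  have hdeg := hA.epsMap_isHomogeneous.inj_right (hεA ▸ hα.mul hqhom)
    (hεA ▸ mul_ne_zero hα0 hq0)
  have hβq : (β * q).IsHomogeneous (i + (j + 1) * μ1 + k * μ2) := by
    convert hβ.mul hqhom using 1
    simp only [add_mul, one_mul] at hdeg ⊢
    omega
  obtain ⟨B, hB, hεB⟩ := exists_triHom_epsMap_eq hβq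
  refine ⟨B, hB, ?_⟩
  rw [map_sub, hA.PhiMap_eq, hB.PhiMap_eq, hεA, hεB, map_mul, map_mul]
  ring
end
end

section
/- Assume 1 ≤ μ2. For every minimal exponent (i,j,k), setting s := i + (j+1)·μ1 + (k+1)·μ2 − d, one has: (1) 0 ≤ s < μ2; and (2) if i > 0 then s = 0. -/
/-- `(i,j,k)` is a minimal exponent: the monomial `V0^i·V1^j·V2^k` is a minimal
monomial generator of the ideal `S_{μ1,μ2,d}`. -/
def MinExp (d μ1 μ2 : ℕ) (i j k : ℕ) : Prop :=
  d - (μ1 + μ2) ≤ i + μ1 * j + μ2 * k ∧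
  (1 ≤ i → ¬ (d - (μ1 + μ2) ≤ (i - 1) + μ1 * j + μ2 * k)) ∧
  (1 ≤ j → ¬ (d - (μ1 + μ2) ≤ i + μ1 * (j - 1) + μ2 * k)) ∧
  (1 ≤ k → ¬ (d - (μ1 + μ2) ≤ i + μ1 * j + μ2 * (k - 1)))

theorem stmt6 (d μ1 μ2 : ℕ) (hμ2 : 1 ≤ μ2) (hμ12 : μ1 ≤ μ2)
    (hd : 2 * (μ1 + μ2) ≤ d) (i j k : ℕ) (h : MinExp d μ1 μ2 i j k) :
    0 ≤ (i : ℤ) + ((j : ℤ) + 1) * μ1 + ((k : ℤ) + 1) * μ2 - d ∧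
    (i : ℤ) + ((j : ℤ) + 1) * μ1 + ((k : ℤ) + 1) * μ2 - d < μ2 ∧
    (0 < i → (i : ℤ) + ((j : ℤ) + 1) * μ1 + ((k : ℤ) + 1) * μ2 - d = 0) := by
  obtain ⟨hmem, hi, hj, hk⟩ := h
  have hbound : (i : ℤ) + μ1 * j + μ2 * k + μ1 + μ2 - d < μ2 := by
    rcases j with _ | j
    · rcases k with _ | k
      · simp only [mul_zero, add_zero] at hmem hi
        push_cast
        omega
      · have := hk (by omega)
        simp only [Nat.add_sub_cancel, mul_zero, add_zero] at this
        push_cast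
        simp only [mul_add, mul_one, mul_zero, add_zero]
        zify [show μ1 + μ2 ≤ d by omega] at this
        linarith
    · have := hj (by omega)
      simp only [Nat.add_sub_cancel] at this
      push_cast
      zify [show μ1 + μ2 ≤ d by omega] at this hμ12
      linarith
  zify [show μ1 + μ2 ≤ d by omega] at hmem
  refine ⟨by linarith, by linarith, fun hpos => ?_⟩
  have := hi hpos
  zify [show μ1 + μ2 ≤ d by omega, show 1 ≤ i from hpos] at this
  linarith
end

section
/- The kernel of ψ equals the preimage under Ω of the principal ideal generated by g = α·Y − β·X; that is, for every F ∈ K[T0,T1,Z_0,Z_1,Z_2], one has ψ(F) = 0 if and only if g divides Ω(F) in K[T0,T1,X,Y]. -/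
open MvPolynomial

noncomputable section

/-- The polynomial ring `K[T0,T1,Z_0,Z_1,Z_2]`. -/
abbrev PTZ (K : Type) [Field K] := MvPolynomial (Fin 2 ⊕ Fin 3) K

/-- The map `ψ : K[T0,T1,Z_0,Z_1,Z_2] → K[T0,T1,s]` with `Z_i ↦ f_i·s`. -/
def psiMap (K : Type) [Field K] (f : Fin 3 → PT K) : PTZ K →ₐ[K] PTs K :=
  aeval (Sum.elim (fun i => X (Sum.inl i))
    (fun i => rename Sum.inl (f i) * X (Sum.inr ())))

/-- The map `Ω : K[T0,T1,Z_0,Z_1,Z_2] → K[T0,T1,X,Y]` with `Z_i ↦ A_i·X + B_i·Y`. -/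
def OmegaMap (K : Type) [Field K] (A B : Fin 3 → PT K) : PTZ K →ₐ[K] PTXY K :=
  aeval (Sum.elim (fun i => X (Sum.inl i))
    (fun i => rename Sum.inl (A i) * X (Sum.inr 0) + rename Sum.inl (B i) * X (Sum.inr 1)))

namespace MvPolynomial

lemma isRelPrime_C_mul_X_sub_C_mul_X {R : Type*} [CommRing R] [IsDomain R] {α β : R}
    (hα : α ≠ 0) (h : IsRelPrime α β) :
    IsRelPrime (C α * X 1 - C β * X 0 : MvPolynomial (Fin 2) R) (C α) := by
  intro c hg hc
  obtain ⟨a, -, rfl⟩ := (dvd_C_iff_exists hα).1 hc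
  rw [C_dvd_iff_dvd_coeff] at hg
  have h0 := hg (Finsupp.single 0 1)
  have h1 := hg (Finsupp.single 1 1)
  simp only [coeff_sub, coeff_C_mul, coeff_X, Finsupp.single_left_inj one_ne_zero] at h0 h1
  simp only [Fin.isValue, one_ne_zero, zero_ne_one, if_true, if_false, mul_one, mul_zero,
    zero_sub, sub_zero, dvd_neg] at h0 h1
  exact (h h1 h0).map C

/-- Pseudo-division by `α * Y - β * X`, with a remainder free of `Y`. -/
lemma exists_dvd_C_pow_mul_sub {R : Type*} [CommRing R] (α β : R)
    (G : MvPolynomial (Fin 2) R) :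
    ∃ (n : ℕ) (r : Polynomial R),
      (C α * X 1 - C β * X 0 : MvPolynomial (Fin 2) R) ∣ C α ^ n * G - Polynomial.aeval (X 0) r := by
  induction G using MvPolynomial.induction_on with
  | C a =>
    refine ⟨0, Polynomial.C a, ?_⟩
    simp [algebraMap_eq]
  | add p q hp hq =>
    obtain ⟨n, r, k, hr⟩ := hp
    obtain ⟨m, t, l, ht⟩ := hq
    refine ⟨n + m, Polynomial.C α ^ m * r + Polynomial.C α ^ n * t, C α ^ m * k + C α ^ n * l, ?_⟩
    simp only [map_add, map_mul, map_pow, Polynomial.aeval_C, algebraMap_eq]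
    linear_combination C α ^ m * hr + C α ^ n * ht
  | mul_X p i hp =>
    obtain ⟨n, r, k, hr⟩ := hp
    fin_cases i
    · refine ⟨n, Polynomial.X * r, X 0 * k, ?_⟩
      simp only [map_mul, Polynomial.aeval_X, Fin.zero_eta]
      linear_combination X 0 * hr
    · refine ⟨n + 1, Polynomial.C β * Polynomial.X * r, C α ^ n * p + C β * X 0 * k, ?_⟩
      simp only [map_mul, Polynomial.aeval_X, Polynomial.aeval_C, algebraMap_eq, Fin.mk_one]
      linear_combination C β * X 0 * hr

/-- For coprime `α` and `β`, the kernel of `X ↦ α s`, `Y ↦ β s` is generated by `α * Y - β * X`. -/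
lemma aeval_C_mul_X_eq_zero_iff {R : Type*} [CommRing R] [IsDomain R]
    [UniqueFactorizationMonoid R] {α β : R} (hα : α ≠ 0) (h : IsRelPrime α β) (G : MvPolynomial (Fin 2) R) :
    aeval ![Polynomial.C α * Polynomial.X, Polynomial.C β * Polynomial.X] G = 0 ↔
      (C α * X 1 - C β * X 0 : MvPolynomial (Fin 2) R) ∣ G := by
  set Θ : MvPolynomial (Fin 2) R →ₐ[R] Polynomial R :=
    aeval ![Polynomial.C α * Polynomial.X, Polynomial.C β * Polynomial.X]
  have hΘ : Θ (C α * X 1 - C β * X 0) = 0 := by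
    simp only [Θ, map_sub, map_mul, aeval_X, algHom_C, Polynomial.algebraMap_eq,
      Matrix.cons_val_zero, Matrix.cons_val_one]
    ring
  constructor
  · intro hG
    obtain ⟨n, r, hr⟩ := exists_dvd_C_pow_mul_sub α β G
    have hr0 : r = 0 := by
      have := (map_dvd Θ hr)
      rw [hΘ, zero_dvd_iff, map_sub, map_mul, hG, mul_zero, zero_sub, neg_eq_zero,
        ← Polynomial.aeval_algHom_apply] at this
      simp only [Θ, aeval_X, Matrix.cons_val_zero] at this
      rwa [← Polynomial.comp_eq_aeval,
        Polynomial.comp_C_mul_X_eq_zero_iff (mem_nonZeroDivisors_of_ne_zero hα)] at this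
    rw [hr0, map_zero, sub_zero] at hr
    exact (isRelPrime_C_mul_X_sub_C_mul_X hα h).pow_right.dvd_of_dvd_mul_left hr
  · rintro ⟨k, rfl⟩
    rw [map_mul, hΘ, zero_mul]

/-- `K[σ, τ]` as polynomials in `τ` over `K[σ]`. -/
def sumAlgEquivRight (K σ τ : Type*) [CommSemiring K] :
    MvPolynomial (σ ⊕ τ) K ≃ₐ[K] MvPolynomial τ (MvPolynomial σ K) :=
  (renameEquiv K (Equiv.sumComm σ τ)).trans (sumAlgEquiv K τ σ)

section sumAlgEquivRight

variable {K σ τ : Type*} [CommSemiring K]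

@[simp]
lemma sumAlgEquivRight_X_inl (i : σ) :
    sumAlgEquivRight K σ τ (X (Sum.inl i)) = C (X i) := by
  simp [sumAlgEquivRight]

@[simp]
lemma sumAlgEquivRight_X_inr (i : τ) :
    sumAlgEquivRight K σ τ (X (Sum.inr i)) = X i := by
  simp [sumAlgEquivRight]

@[simp]
lemma sumAlgEquivRight_rename_inl (p : MvPolynomial σ K) :
    sumAlgEquivRight K σ τ (rename Sum.inl p) = C p := by
  have : (sumAlgEquivRight K σ τ).toAlgHom.comp (rename Sum.inl) =
      IsScalarTower.toAlgHom K (MvPolynomial σ K) (MvPolynomial τ (MvPolynomial σ K)) := by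
    ext1 i
    simp [algebraMap_eq]
  exact DFunLike.congr_fun this p

end sumAlgEquivRight

end MvPolynomial

theorem stmt9 (K : Type) [Field K] (d μ1 μ2 : ℕ) (hμ12 : μ1 ≤ μ2)
    (hd : 2 * (μ1 + μ2) ≤ d)
    (α β : PT K) (hα0 : α ≠ 0) (hβ0 : β ≠ 0)
    (hα : α.IsHomogeneous (d - μ1)) (hβ : β.IsHomogeneous (d - μ2))
    (hcop : ∀ c : PT K, c ∣ α → c ∣ β → IsUnit c)
    (A B : Fin 3 → PT K)
    (hAhom : ∀ i, (A i).IsHomogeneous μ1) (hBhom : ∀ i, (B i).IsHomogeneous μ2)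
    (f : Fin 3 → PT K) (hf : ∀ i, f i = α * A i + β * B i) :
    ∀ F : PTZ K, psiMap K f F = 0 ↔
      ((rename Sum.inl α : PTXY K) * X (Sum.inr 1)
        - (rename Sum.inl β : PTXY K) * X (Sum.inr 0)) ∣ OmegaMap K A B F := by
  intro F
  let Λ : PTs K ≃ₐ[K] Polynomial (PT K) :=
    (sumAlgEquivRight K (Fin 2) Unit).trans ((uniqueAlgEquiv (PT K) Unit).restrictScalars K)
  let e := sumAlgEquivRight K (Fin 2) (Fin 2)
  let Θ : MvPolynomial (Fin 2) (PT K) →ₐ[PT K] Polynomial (PT K) :=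
    aeval ![Polynomial.C α * Polynomial.X, Polynomial.C β * Polynomial.X]
  have hcomm : (Λ : PTs K →ₐ[K] Polynomial (PT K)).comp (psiMap K f) =
      (Θ.restrictScalars K).comp ((e : PTXY K →ₐ[K] _).comp (OmegaMap K A B)) := by
    ext1 i
    rcases i with i | i
    · simp [Λ, e, Θ, psiMap, OmegaMap]
    · simp [Λ, e, Θ, psiMap, OmegaMap, hf]
      ring
  have hF : Λ (psiMap K f F) = Θ (e (OmegaMap K A B F)) := DFunLike.congr_fun hcomm F
  rw [← map_eq_zero_iff Λ Λ.injective, hF, aeval_C_mul_X_eq_zero_iff hα0 (fun c => hcop c),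
    ← map_dvd_iff e]
  simp [e]
end
end

section
/- Let p_0, p_1, p_2 ∈ K[T0,T1] be homogeneous of degree μ = μ1 + μ2, and suppose A = (A_0,A_1,A_2), B = (B_0,B_1,B_2) ∈ K[T0,T1]³, with each A_i homogeneous of degree μ1 and each B_i homogeneous of degree μ2, satisfy: Σ_i A_i·p_i = 0 = Σ_i B_i·p_i; every (h_0,h_1,h_2) ∈ K[T0,T1]³ with Σ_i h_i·p_i = 0 equals u·A + v·B for some u,v ∈ K[T0,T1]; and u·A + v·B = 0 implies u = v = 0. Then for every integer i ≥ μ + μ2 − 1, every homogeneous polynomial of degree i in K[T0,T1] belongs to the ideal ⟨p_0, p_1, p_2⟩. -/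
open MvPolynomial

noncomputable section

/-- The linear map sending a coefficient vector `c` of length `n` to the binary form
`∑ j, c j • T0 ^ j * T1 ^ (n - 1 - j)` of degree `n - 1`; it is zero for `n = 0`. -/
def binaryForm (K : Type) [Field K] (n : ℕ) : (Fin n → K) →ₗ[K] PT K :=
  Fintype.linearCombination K fun j : Fin n =>
    monomial (Finsupp.single (0 : Fin 2) (j : ℕ) + Finsupp.single (1 : Fin 2) (n - 1 - j : ℕ)) 1

section binaryForm

variable {K : Type} [Field K]

theorem binaryForm_injective (n : ℕ) : Function.Injective (binaryForm K n) := by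
  have h := (MvPolynomial.basisMonomials (Fin 2) K).linearIndependent.comp
    (fun j : Fin n => Finsupp.single (0 : Fin 2) (j : ℕ) +
      Finsupp.single (1 : Fin 2) (n - 1 - j : ℕ)) fun a b hab => by
        simpa [Fin.ext_iff] using DFunLike.congr_fun hab 0
  rw [coe_basisMonomials] at h
  exact h.fintypeLinearCombination_injective

theorem mem_range_binaryForm {n : ℕ} {f : PT K} (hf : f.IsHomogeneous n) :
    f ∈ LinearMap.range (binaryForm K (n + 1)) := by
  rw [f.as_sum]
  refine Submodule.sum_mem _ fun d hd => ?_
  have hdeg : d 0 + d 1 = n := by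
    have := hf (mem_support_iff.mp hd)
    simpa [Finsupp.weight_apply, Finsupp.sum_fintype] using this
  have hd0 : d 0 < n + 1 := by omega
  refine ⟨Pi.single ⟨d 0, hd0⟩ (coeff d f), ?_⟩
  have hd' : Finsupp.single (0 : Fin 2) (d 0) + Finsupp.single (1 : Fin 2) (n + 1 - 1 - d 0) = d := by
    ext i
    fin_cases i <;> simp
    omega
  rw [binaryForm, Fintype.linearCombination_apply_single, hd', smul_monomial, smul_eq_mul, mul_one]

theorem isHomogeneous_binaryForm {n : ℕ} (c : Fin (n + 1) → K) :
    (binaryForm K (n + 1) c).IsHomogeneous n := by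
  rw [binaryForm, Fintype.linearCombination_apply]
  refine IsHomogeneous.sum _ _ _ fun j _ => ?_
  rw [smul_monomial]
  refine isHomogeneous_monomial _ ?_
  rw [map_add, Finsupp.degree_single, Finsupp.degree_single]
  omega

attribute [local instance] MvPolynomial.gradedAlgebra in
theorem exists_homogeneousComponent_mul_eq_binaryForm_mul (u : PT K) (m k : ℕ) :
    ∃ a : Fin (k + 1 - m) → K, ∀ A : PT K, A.IsHomogeneous m →
      homogeneousComponent k (u * A) = binaryForm K (k + 1 - m) a * A := by
  have key (n : ℕ) (f : PT K) : (DirectSum.decompose (homogeneousSubmodule (Fin 2) K) f n : PT K) =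
      homogeneousComponent n f := decomposition.decompose'_apply f n
  rcases le_or_gt m k with h | h
  · obtain ⟨a, ha⟩ := mem_range_binaryForm (homogeneousComponent_isHomogeneous (k - m) u)
    obtain ⟨l, rfl⟩ := Nat.exists_eq_add_of_le h
    have e : m + l + 1 - m = m + l - m + 1 := by omega
    rw [e]
    refine ⟨a, fun A hA => ?_⟩
    rw [ha, ← key, ← key, DirectSum.coe_decompose_mul_of_right_mem_of_le _ hA h]
  · refine ⟨0, fun A hA => ?_⟩
    rw [← key, DirectSum.coe_decompose_mul_of_right_mem_of_not_le _ hA (by omega)]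
    simp

end binaryForm

theorem stmt13 (K : Type) [Field K] (μ1 μ2 : ℕ) (hμ12 : μ1 ≤ μ2)
    (p : Fin 3 → PT K) (hphom : ∀ i, (p i).IsHomogeneous (μ1 + μ2))
    (A B : Fin 3 → PT K)
    (hAhom : ∀ i, (A i).IsHomogeneous μ1) (hBhom : ∀ i, (B i).IsHomogeneous μ2)
    (hsyzA : ∑ i : Fin 3, A i * p i = 0) (hsyzB : ∑ i : Fin 3, B i * p i = 0)
    (hgen : ∀ h : Fin 3 → PT K, (∑ i : Fin 3, h i * p i = 0) →
      ∃ u v : PT K, ∀ i, h i = u * A i + v * B i)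
    (hindep : ∀ u v : PT K, (∀ i, u * A i + v * B i = 0) → u = 0 ∧ v = 0) :
    ∀ i : ℕ, μ1 + μ2 + μ2 - 1 ≤ i →
      ∀ h : PT K, h.IsHomogeneous i → h ∈ Ideal.span {p 0, p 1, p 2} := by
  intro i hi h hh
  obtain ⟨k, rfl⟩ : ∃ k, i = μ1 + μ2 + k := Nat.exists_eq_add_of_le (by omega)
  let G : (Fin 3 → Fin (k + 1) → K) →ₗ[K] (Fin 3 → PT K) :=
    LinearMap.pi fun j => binaryForm K (k + 1) ∘ₗ LinearMap.proj j
  let S : (Fin 3 → PT K) →ₗ[K] PT K :=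
    ∑ j, LinearMap.mulRight K (p j) ∘ₗ LinearMap.proj j
  let Φ := S ∘ₗ G
  let Ψ : ((Fin (k + 1 - μ1) → K) × (Fin (k + 1 - μ2) → K)) →ₗ[K] (Fin 3 → PT K) :=
    LinearMap.pi fun j =>
      (LinearMap.mulRight K (A j) ∘ₗ binaryForm K _).coprod
        (LinearMap.mulRight K (B j) ∘ₗ binaryForm K _)
  have hΦ (c) : Φ c = ∑ j, binaryForm K (k + 1) (c j) * p j := by
    simp [Φ, S, G]
  have hG : Function.Injective G := fun c d hcd =>
    funext fun j => binaryForm_injective (k + 1) (congrFun hcd j)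
  have hker : (LinearMap.ker Φ).map G ≤ LinearMap.range Ψ := by
    rintro _ ⟨c, hc, rfl⟩
    obtain ⟨u, v, huv⟩ := hgen (G c) (by rw [← LinearMap.mem_ker.mp hc, hΦ]; rfl)
    obtain ⟨a, ha⟩ := exists_homogeneousComponent_mul_eq_binaryForm_mul u μ1 k
    obtain ⟨b, hb⟩ := exists_homogeneousComponent_mul_eq_binaryForm_mul v μ2 k
    refine ⟨(a, b), funext fun j => ?_⟩
    have hj : (G c j).IsHomogeneous k := isHomogeneous_binaryForm (c j)
    rw [← homogeneousComponent_eq_self hj, huv, map_add, ha _ (hAhom j), hb _ (hBhom j)]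
    rfl
  have hkerdim : Module.finrank K (LinearMap.ker Φ) ≤ (k + 1 - μ1) + (k + 1 - μ2) := by
    rw [(Submodule.equivMapOfInjective G hG _).finrank_eq]
    refine (Submodule.finrank_mono hker).trans ((LinearMap.finrank_range_le Ψ).trans ?_)
    simp
  have hrange : LinearMap.range Φ ≤ LinearMap.range (binaryForm K (μ1 + μ2 + k + 1)) := by
    rintro _ ⟨c, rfl⟩
    refine mem_range_binaryForm ?_
    rw [hΦ]
    refine IsHomogeneous.sum _ _ _ fun j _ => ?_
    exact add_comm k (μ1 + μ2) ▸ (isHomogeneous_binaryForm (c j)).mul (hphom j)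
  have hrank := Φ.finrank_range_add_finrank_ker
  have htarget := LinearMap.finrank_range_le (binaryForm K (μ1 + μ2 + k + 1))
  simp only [Module.finrank_pi_fintype, Module.finrank_self, Finset.sum_const, Finset.card_univ,
    Fintype.card_fin, smul_eq_mul, mul_one] at hrank htarget
  have heq := Submodule.eq_of_le_of_finrank_le hrange (by omega)
  obtain ⟨c, rfl⟩ : h ∈ LinearMap.range Φ := heq ▸ mem_range_binaryForm hh
  rw [hΦ]
  refine Ideal.sum_mem _ fun j _ => Ideal.mul_mem_left _ _ (Ideal.subset_span ?_)
  fin_cases j <;> simp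
end
end
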